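/- Let N = 2n ≥ 4 be even, write ℝ^N = ℝ^n × ℝ^n, and let α > 0. If max{4(N+2)/β_1 + 2, (2N+2α−4)/(N−2)} < p < (2N+2α)/(N−2), where β_1 = inf_{u ∈ H^1(ℝ^N)} (∫_{ℝ^N}|∇u|² dx + ∫_{ℝ^N} u² dx)/(∫_{ℝ^N} u²/|x|² dx), then the positive classical K_+ ground state solution u of −Δu + u = |x|^α u^{p−1} in ℝ^N is nonradial. -/

import Mathlib

open MeasureTheory Real Set Filter

noncomputable section

abbrev Euc (N : ℕ) := EuclideanSpace ℝ (Fin N)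

variable {N : ℕ}

/-- The Euclidean Laplacian. -/
def lap (u : Euc N → ℝ) (x : Euc N) : ℝ :=
  ∑ i : Fin N,
    iteratedFDeriv ℝ 2 u x ![EuclideanSpace.single i 1, EuclideanSpace.single i 1]

/-- `s = (x₁² + ⋯ + xₙ²)^{1/2}`. -/
def sVar (n : ℕ) (x : Euc N) : ℝ :=
  Real.sqrt (∑ j : Fin N, if (j : ℕ) < n then x j ^ 2 else 0)

/-- `t = (x_{n+1}² + ⋯ + x_N²)^{1/2}`. -/
def tVar (n : ℕ) (x : Euc N) : ℝ :=
  Real.sqrt (∑ j : Fin N, if n ≤ (j : ℕ) then x j ^ 2 else 0)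

/-- Pragmatic membership in `H¹(ℝ^N)` (continuous representative). -/
def MemH1 (u : Euc N → ℝ) : Prop :=
  Continuous u ∧ (∀ x, DifferentiableAt ℝ u x) ∧
    Integrable (fun x => ‖gradient u x‖ ^ 2) volume ∧
    Integrable (fun x => u x ^ 2) volume

/-- The cone `K₊` on the full space `ℝ^N = ℝ^n × ℝ^n`: nonnegative `G = O(n)×O(n)`
invariant functions in `H¹(ℝ^N)`, even across `θ = π/4` and nondecreasing in `θ` on
`(0, π/4)`. -/
def KplusFull (n : ℕ) : Set (Euc N → ℝ) :=
  { u | MemH1 u ∧ (∀ x, 0 ≤ u x) ∧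
      ∃ w : ℝ → ℝ → ℝ,
        (∀ x, u x = w (sVar n x) (tVar n x)) ∧
        (∀ s t, w s t = w t s) ∧
        (∀ r θ₁ θ₂ : ℝ, 0 < r → 0 < θ₁ → θ₁ ≤ θ₂ → θ₂ < π / 4 →
          w (r * Real.cos θ₁) (r * Real.sin θ₁) ≤ w (r * Real.cos θ₂) (r * Real.sin θ₂)) }

/-- The energy `E(u) = (1/2)∫(|∇u|² + u²) − (1/p)∫ |x|^α |u|^p` on `ℝ^N`. -/
def energy (α p : ℝ) (u : Euc N → ℝ) : ℝ :=
  (1 / 2) * (∫ x, (‖gradient u x‖ ^ 2 + u x ^ 2)) -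
    (1 / p) * (∫ x, ‖x‖ ^ α * |u x| ^ p)

/-- The norm of the space `V = H¹(ℝ^N) ∩ L^p(ℝ^N, |x|^α dx)`. -/
def vnorm (α p : ℝ) (u : Euc N → ℝ) : ℝ :=
  (∫ x, (‖gradient u x‖ ^ 2 + u x ^ 2)) ^ (1 / 2 : ℝ) +
    (∫ x, ‖x‖ ^ α * |u x| ^ p) ^ (1 / p)

/-- The mountain pass level of the energy restricted to `K`. -/
def mountainPassLevel (α p : ℝ) (K : Set (Euc N → ℝ)) : ℝ :=
  sInf { c : ℝ | ∃ γ : ℝ → Euc N → ℝ,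
    (∀ t ∈ Icc (0 : ℝ) 1, γ t ∈ K) ∧
    (∀ t ∈ Icc (0 : ℝ) 1, ∀ ε > (0 : ℝ), ∃ δ > (0 : ℝ), ∀ s ∈ Icc (0 : ℝ) 1,
      |s - t| < δ → vnorm α p (γ s - γ t) < ε) ∧
    γ 0 = 0 ∧ γ 1 ≠ 0 ∧ energy α p (γ 1) ≤ 0 ∧
    c = sSup ((fun t => energy α p (γ t)) '' Icc (0 : ℝ) 1) }

/-- `u` is a `K` ground state of the energy on `ℝ^N`. -/
def IsGroundState (α p : ℝ) (K : Set (Euc N → ℝ)) (u : Euc N → ℝ) : Prop :=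
  u ∈ K ∧ 0 < energy α p u ∧ energy α p u = mountainPassLevel α p K

/-- A radial function. -/
def IsRadial (u : Euc N → ℝ) : Prop :=
  ∃ f : ℝ → ℝ, ∀ x, u x = f ‖x‖

/-- The best constant `β₁` in the Hardy-type inequality
`β₁ ∫ u²/|x|² ≤ ∫ |∇u|² + ∫ u²` on `ℝ^N`. -/
def beta1 (N : ℕ) : ℝ :=
  sInf { q : ℝ | ∃ u : Euc N → ℝ, MemH1 u ∧
    (0 < ∫ x : Euc N, u x ^ 2 / ‖x‖ ^ 2) ∧
    q = ((∫ x : Euc N, ‖gradient u x‖ ^ 2) + ∫ x : Euc N, u x ^ 2) /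
        (∫ x : Euc N, u x ^ 2 / ‖x‖ ^ 2) }

section helpers
open scoped Topology RealInnerProductSpace

lemma hg_mul {f g : Euc N → ℝ} {f' g' : Euc N} {x : Euc N} (hf : HasGradientAt f f' x)
    (hg : HasGradientAt g g' x) :
    HasGradientAt (fun y => f y * g y) (f x • g' + g x • f') x := by
  rw [hasGradientAt_iff_hasFDerivAt] at *
  simpa using hf.fun_mul hg

lemma hg_add {f g : Euc N → ℝ} {f' g' : Euc N} {x : Euc N} (hf : HasGradientAt f f' x)
    (hg : HasGradientAt g g' x) :
    HasGradientAt (fun y => f y + g y) (f' + g') x := by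
  rw [hasGradientAt_iff_hasFDerivAt] at *
  simpa using hf.fun_add hg

lemma hg_smul {f : Euc N → ℝ} {f' : Euc N} {x : Euc N} (c : ℝ) (hf : HasGradientAt f f' x) :
    HasGradientAt (fun y => c * f y) (c • f') x := by
  rw [hasGradientAt_iff_hasFDerivAt] at *
  simpa using hf.const_mul c

lemma hg_comp {φ : ℝ → ℝ} {φ' : ℝ} {f : Euc N → ℝ} {f' : Euc N} {x : Euc N}
    (hφ : HasDerivAt φ φ' (f x)) (hf : HasGradientAt f f' x) :
    HasGradientAt (fun y => φ (f y)) (φ' • f') x := by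
  rw [hasGradientAt_iff_hasFDerivAt] at *
  have h := hφ.comp_hasFDerivAt x hf
  rw [map_smul]
  exact h

lemma hg_sum {ι : Type*} (s : Finset ι) {f : ι → Euc N → ℝ} {f' : ι → Euc N} {x : Euc N}
    (hf : ∀ i ∈ s, HasGradientAt (f i) (f' i) x) :
    HasGradientAt (fun y => ∑ i ∈ s, f i y) (∑ i ∈ s, f' i) x := by
  simp only [hasGradientAt_iff_hasFDerivAt] at *
  simpa using HasFDerivAt.fun_sum hf

lemma hg_coord (i : Fin N) (x : Euc N) :
    HasGradientAt (fun y : Euc N => y i) (EuclideanSpace.single i (1:ℝ)) x := by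
  rw [hasGradientAt_iff_hasFDerivAt]
  have h := (EuclideanSpace.proj i : Euc N →L[ℝ] ℝ).hasFDerivAt (x := x)
  have e : InnerProductSpace.toDual ℝ (Euc N) (EuclideanSpace.single i (1:ℝ)) =
      (EuclideanSpace.proj i : Euc N →L[ℝ] ℝ) := by
    ext y
    simp [EuclideanSpace.inner_single_left]
  exact e ▸ h

lemma hg_nsq (x : Euc N) : HasGradientAt (fun y : Euc N => ‖y‖ ^ 2) ((2:ℝ) • x) x := by
  rw [hasGradientAt_iff_hasFDerivAt]
  have h := (hasStrictFDerivAt_norm_sq x).hasFDerivAt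
  have e : InnerProductSpace.toDual ℝ (Euc N) ((2:ℝ) • x) = 2 • innerSL ℝ x := by
    ext y
    simp [inner_smul_left]
  rw [e]
  exact h

lemma hg_fd {f : Euc N → ℝ} {f' : Euc N} {x : Euc N} (hf : HasGradientAt f f' x) (i : Fin N) :
    fderiv ℝ f x (EuclideanSpace.single i 1) = f' i := by
  rw [hf.fderiv_apply]; simp [EuclideanSpace.inner_single_right]

/-- divergence theorem -/
lemma int_div (V : Fin N → Euc N → ℝ) (G : Fin N → Euc N → Euc N)
    (h : ∀ i x, HasGradientAt (V i) (G i x) x) (hV : ∀ i, Integrable (V i))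
    (hG : ∀ i, Integrable (fun x => G i x i)) : ∫ x, ∑ i, G i x i = 0 := by
  rw [integral_finsetSum _ (fun i _ => hG i)]
  refine Finset.sum_eq_zero fun i _ => ?_
  have := integral_mul_fderiv_eq_neg_fderiv_mul_of_integrable (𝕜 := ℝ) (μ := volume)
    (f := fun _ : Euc N => (1:ℝ)) (g := V i) (v := EuclideanSpace.single i 1) (by simp)
    (by simpa [hg_fd (h i _)] using hG i) (by simpa using hV i)
    (fun x _ => differentiableAt_const _) (fun x _ => (h i x).differentiableAt)
  simpa [hg_fd (h i _)] using this

lemma int_div_mul (F : Euc N → ℝ) (F' : Euc N → Euc N) (X : Euc N → Euc N)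
    (dX : Fin N → Euc N → Euc N) (hF : ∀ x, HasGradientAt F (F' x) x)
    (hX : ∀ i x, HasGradientAt (fun y => X y i) (dX i x) x)
    (h1 : ∀ i, Integrable (fun x => F x * X x i))
    (h2 : ∀ i, Integrable (fun x => F x * dX i x i + X x i * F' x i)) :
    ∫ x, (F x * (∑ i, dX i x i) + inner ℝ (F' x) (X x)) = 0 := by
  have := int_div (fun i x => F x * X x i) (fun i x => F x • dX i x + X x i • F' x)
    (fun i x => hg_mul (hF x) (hX i x)) h1 (fun i => by simpa using h2 i)
  rw [← this]
  congr 1; ext x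
  simp [Finset.sum_add_distrib, Finset.mul_sum, PiLp.inner_apply]

lemma hg_zero_out {F : Euc N → ℝ} {F' : Euc N → Euc N} {R : ℝ}
    (hF : ∀ x, HasGradientAt F (F' x) x) (h0 : ∀ x, R < ‖x‖ → F x = 0) :
    ∀ x, R < ‖x‖ → F' x = 0 := by
  intro x hx
  have : F =ᶠ[𝓝 x] fun _ => 0 := by
    filter_upwards [(isOpen_lt continuous_const continuous_norm).mem_nhds hx] with y hy
    exact h0 y hy
  exact (hF x).unique ((hasGradientAt_const x (0:ℝ)).congr_of_eventuallyEq this)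

lemma integrable_of_out {f : Euc N → ℝ} (hf : Continuous f) {R : ℝ}
    (h0 : ∀ x, R < ‖x‖ → f x = 0) : Integrable f := by
  apply hf.integrable_of_hasCompactSupport
  apply HasCompactSupport.intro (isCompact_closedBall (0 : Euc N) R)
  intro x hx
  apply h0
  simpa using hx

lemma int_div_cpt (F : Euc N → ℝ) (F' : Euc N → Euc N) (X : Euc N → Euc N)
    (dX : Fin N → Euc N → Euc N) (hF : ∀ x, HasGradientAt F (F' x) x)
    (hX : ∀ i x, HasGradientAt (fun y => X y i) (dX i x) x)
    (hF' : Continuous F') (hXc : Continuous X) (hdX : ∀ i, Continuous (fun x => dX i x i))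
    {R : ℝ} (h0 : ∀ x, R < ‖x‖ → F x = 0) :
    ∫ x, (F x * (∑ i, dX i x i) + inner ℝ (F' x) (X x)) = 0 := by
  have hFc : Continuous F := continuous_iff_continuousAt.2 fun x => (hF x).differentiableAt.continuousAt
  have hF0 := hg_zero_out hF h0
  have e : ∀ i, Continuous fun y : Euc N => y i := fun i => by fun_prop
  have e1 := fun i => (e i).comp hXc
  have e2 := fun i => (e i).comp hF'
  simp only [Function.comp_def] at e1 e2
  refine int_div_mul F F' X dX hF hX (fun i => integrable_of_out (R := R) (hFc.mul (e1 i)) ?_)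
    (fun i => integrable_of_out (R := R) ((hFc.mul (hdX i)).add ((e1 i).mul (e2 i))) ?_)
  · intro x hx; simp [h0 x hx]
  · intro x hx; simp [h0 x hx, hF0 x hx]

lemma fatou_int {f : ℕ → Euc N → ℝ} {g : Euc N → ℝ} {C : ℝ} (hf : ∀ k, Integrable (f k))
    (h0 : ∀ k x, 0 ≤ f k x) (hC : ∀ k, ∫ x, f k x ≤ C)
    (ht : ∀ᵐ x, Tendsto (fun k => f k x) atTop (𝓝 (g x))) :
    Integrable g ∧ ∫ x, g x ≤ C := by
  have hC0 : 0 ≤ C := (integral_nonneg (h0 0)).trans (hC 0)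
  have hm : AEStronglyMeasurable g volume :=
    aestronglyMeasurable_of_tendsto_ae _ (fun k => (hf k).1) ht
  have hb : ∫⁻ x, ‖g x‖ₑ ≤ ENNReal.ofReal C := by
    have e : ∫⁻ x, ‖g x‖ₑ = ∫⁻ x, liminf (fun k => ‖f k x‖ₑ) atTop := by
      refine lintegral_congr_ae ?_
      filter_upwards [ht] with x hx
      exact ((continuous_enorm.tendsto _).comp hx).liminf_eq.symm
    rw [e]
    refine (lintegral_liminf_le' (fun n ↦ (hf n).1.aemeasurable.enorm)).trans ?_
    refine Filter.liminf_le_of_le (by isBoundedDefault) ?_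
    intro b hb
    obtain ⟨k, hk⟩ := hb.exists
    refine hk.trans ?_
    rw [← ofReal_integral_norm_eq_lintegral_enorm (hf k)]
    refine ENNReal.ofReal_le_ofReal ?_
    simpa [abs_of_nonneg (h0 k _)] using hC k
  have hi : Integrable g := ⟨hm, hb.trans_lt ENNReal.ofReal_lt_top⟩
  refine ⟨hi, ?_⟩
  have : ∫ x, ‖g x‖ ≤ C := by
    rw [← ENNReal.ofReal_le_ofReal_iff hC0, ofReal_integral_norm_eq_lintegral_enorm hi]
    exact hb
  exact (integral_mono hi hi.norm (fun x => le_abs_self _)).trans this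

lemma meas_gradient (u : Euc N → ℝ) : Measurable (gradient u) :=
  (InnerProductSpace.toDual ℝ (Euc N)).symm.continuous.measurable.comp (measurable_fderiv ℝ u)

lemma coord_le (x : Euc N) (i : Fin N) : |x i| ≤ ‖x‖ := by
  simpa using PiLp.norm_apply_le x i

lemma coord_sq_le (x : Euc N) (i : Fin N) : x i ^ 2 ≤ ‖x‖ ^ 2 := by
  rw [← sq_abs]; exact pow_le_pow_left₀ (abs_nonneg _) (coord_le x i) 2

lemma hardy_aux (hN : 4 ≤ N) {u : Euc N → ℝ} (hu : MemH1 u) {δ : ℝ} (hδ : 0 < δ) :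
    Integrable (fun x => u x ^ 2 * (‖x‖ ^ 2 + δ)⁻¹) ∧
    ∫ x, u x ^ 2 * (‖x‖ ^ 2 + δ)⁻¹ ≤ ∫ x, ‖gradient u x‖ ^ 2 := by
  obtain ⟨huc, hud, hg, hu2⟩ := hu
  have hpos : ∀ x : Euc N, 0 < ‖x‖ ^ 2 + δ := fun x => by positivity
  have hmg := meas_gradient u
  have hmu := huc.measurable
  have hmi : ∀ i, Measurable fun x : Euc N => x i := fun i => by fun_prop
  have hmgi : ∀ i, Measurable fun x : Euc N => gradient u x i := fun i => (hmi i).comp hmg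
  have hkδ : ∀ x : Euc N, (‖x‖ ^ 2 + δ)⁻¹ ≤ δ⁻¹ := fun x =>
    inv_anti₀ hδ (by nlinarith [sq_nonneg ‖x‖])
  have hk0 : ∀ x : Euc N, 0 < (‖x‖ ^ 2 + δ)⁻¹ := fun x => inv_pos.2 (hpos x)
  have hkr : ∀ x : Euc N, (‖x‖ ^ 2 + δ)⁻¹ * ‖x‖ ^ 2 ≤ 1 := fun x => by
    rw [inv_mul_le_iff₀ (hpos x)]; linarith
  have i1 : Integrable (fun x => u x ^ 2 * (‖x‖ ^ 2 + δ)⁻¹) := by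
    refine (hu2.mul_const δ⁻¹).mono' (by measurability) (ae_of_all _ fun x => ?_)
    rw [Real.norm_of_nonneg (by have := hk0 x; positivity)]
    exact mul_le_mul_of_nonneg_left (hkδ x) (sq_nonneg _)
  refine ⟨i1, ?_⟩
  have hk : ∀ x : Euc N, HasGradientAt (fun y : Euc N => (‖y‖ ^ 2 + δ)⁻¹)
      ((-((‖x‖ ^ 2 + δ)⁻¹ ^ 2)) • ((2:ℝ) • x)) x := fun x => by
    have hd : HasDerivAt (fun t : ℝ => (t + δ)⁻¹) (-((‖x‖ ^ 2 + δ)⁻¹ ^ 2)) (‖x‖ ^ 2) := by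
      have h0 := ((hasDerivAt_id (‖x‖ ^ 2)).add_const δ).fun_inv (hpos x).ne'
      have e : -((‖x‖ ^ 2 + δ)⁻¹ ^ 2) = -1 / (id (‖x‖ ^ 2) + δ) ^ 2 := by
        simp [div_eq_mul_inv]
      rw [e]
      exact h0
    exact hg_comp (f := fun y : Euc N => ‖y‖ ^ 2) hd (hg_nsq x)
  have hu' : ∀ x, HasGradientAt (fun y => u y ^ 2) ((2 * u x) • gradient u x) x := fun x => by
    have := hg_comp (hasDerivAt_pow 2 (u x)) (hud x).hasGradientAt
    simpa using this
  have hF := fun x => hg_mul (hu' x) (hk x)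
  have key := int_div_mul (fun x => u x ^ 2 * (‖x‖ ^ 2 + δ)⁻¹) _ (fun x => x)
    (fun i _ => EuclideanSpace.single i 1) hF (fun i x => hg_coord i x) ?_ ?_
  · have b : ∀ x : Euc N, u x ^ 2 * (‖x‖ ^ 2 + δ)⁻¹ - ‖gradient u x‖ ^ 2 ≤
        u x ^ 2 * (‖x‖ ^ 2 + δ)⁻¹ * ∑ i : Fin N, (EuclideanSpace.single i (1:ℝ) : Euc N) i +
        inner ℝ (u x ^ 2 • -((‖x‖ ^ 2 + δ)⁻¹ ^ 2) • (2:ℝ) • x +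
          (‖x‖ ^ 2 + δ)⁻¹ • (2 * u x) • gradient u x) x := by
      intro x
      simp only [inner_add_left, inner_smul_left, real_inner_self_eq_norm_sq]
      simp only [conj_trivial, PiLp.single_apply, if_true, Finset.sum_const, Finset.card_univ, Fintype.card_fin,
        nsmul_eq_mul, mul_one]
      have hc := abs_le.1 (abs_real_inner_le_norm (gradient u x) x)
      have h1 := hkr x
      have h2 := hk0 x
      set k := (‖x‖ ^ 2 + δ)⁻¹
      set a := ‖gradient u x‖
      set r := ‖x‖
      set q := inner ℝ (gradient u x) x
      have hN' : (4:ℝ) ≤ N := by exact_mod_cast hN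
      have e1 : -(u x ^ 2 + r ^ 2 * a ^ 2) ≤ 2 * u x * q := by
        have : q ^ 2 ≤ (a * r) ^ 2 := sq_le_sq' (by linarith [hc.1]) hc.2
        nlinarith [sq_nonneg (u x + q)]
      have e2 : k * (2 * u x * q) ≥ - (u x ^ 2 * k) - a ^ 2 := by
        have := mul_le_mul_of_nonneg_left e1 h2.le
        have h3 := mul_le_mul_of_nonneg_right h1 (sq_nonneg a)
        nlinarith
      have e3 : u x ^ 2 * (k ^ 2 * (2 * r ^ 2)) ≤ 2 * (u x ^ 2 * k) := by
        have h3 := mul_le_mul_of_nonneg_left h1 (show 0 ≤ 2 * (u x ^ 2 * k) by positivity)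
        nlinarith
      have e4 : 4 * (u x ^ 2 * k) ≤ u x ^ 2 * k * N := by
        have h3 := mul_le_mul_of_nonneg_left hN' (show 0 ≤ (u x ^ 2 * k) by positivity)
        nlinarith
      nlinarith
    by_cases hI : Integrable (fun x : Euc N => u x ^ 2 * (‖x‖ ^ 2 + δ)⁻¹ * ∑ i : Fin N, (EuclideanSpace.single i (1:ℝ) : Euc N) i +
        inner ℝ (u x ^ 2 • -((‖x‖ ^ 2 + δ)⁻¹ ^ 2) • (2:ℝ) • x +
          (‖x‖ ^ 2 + δ)⁻¹ • (2 * u x) • gradient u x) x)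
    · have := integral_mono (i1.sub hg) hI b
      rw [key] at this
      have e := integral_sub i1 hg
      simp only [Pi.sub_apply] at this
      rw [e] at this
      linarith
    · exfalso
      apply hI
      have hm : AEStronglyMeasurable (fun x : Euc N => u x ^ 2 * (‖x‖ ^ 2 + δ)⁻¹ * ∑ i : Fin N, (EuclideanSpace.single i (1:ℝ) : Euc N) i +
        inner ℝ (u x ^ 2 • -((‖x‖ ^ 2 + δ)⁻¹ ^ 2) • (2:ℝ) • x +
          (‖x‖ ^ 2 + δ)⁻¹ • (2 * u x) • gradient u x) x) := by
        apply Measurable.aestronglyMeasurable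
        fun_prop
      refine ((i1.const_mul (N + 3)).add hg).mono' hm (ae_of_all _ fun x => ?_)
      simp only [inner_add_left, inner_smul_left, real_inner_self_eq_norm_sq, Pi.add_apply]
      simp only [conj_trivial, PiLp.single_apply, if_true, Finset.sum_const, Finset.card_univ, Fintype.card_fin,
        nsmul_eq_mul, mul_one]
      have hc := abs_le.1 (abs_real_inner_le_norm (gradient u x) x)
      have h1 := hkr x
      have h2 := hk0 x
      set k := (‖x‖ ^ 2 + δ)⁻¹
      set a := ‖gradient u x‖
      set r := ‖x‖
      set q := inner ℝ (gradient u x) x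
      have hq : q ^ 2 ≤ (a * r) ^ 2 := sq_le_sq' (by linarith [hc.1]) hc.2
      have e1 : |2 * u x * q| ≤ (u x ^ 2 + r ^ 2 * a ^ 2) := by
        rw [abs_le]; constructor
        · nlinarith [sq_nonneg (u x + q)]
        · nlinarith [sq_nonneg (u x - q)]
      have e2 : |k * (2 * u x * q)| ≤ (u x ^ 2 * k) + a ^ 2 := by
        rw [abs_mul, abs_of_pos h2]
        have := mul_le_mul_of_nonneg_left e1 h2.le
        have h3 := mul_le_mul_of_nonneg_right h1 (sq_nonneg a)
        nlinarith
      have e3 : u x ^ 2 * (k ^ 2 * (2 * r ^ 2)) ≤ 2 * (u x ^ 2 * k) := by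
        have h3 := mul_le_mul_of_nonneg_left h1 (show 0 ≤ 2 * (u x ^ 2 * k) by positivity)
        nlinarith
      have e4 : 0 ≤ u x ^ 2 * (k ^ 2 * (2 * r ^ 2)) := by positivity
      have e5 : 0 ≤ u x ^ 2 * k := by positivity
      have e6 : 0 ≤ u x ^ 2 * k * N := by positivity
      have := abs_le.1 e2
      rw [Real.norm_eq_abs, abs_le]
      constructor <;> nlinarith
  · intro i
    refine (hu2.mul_const ((1 + δ⁻¹))).mono' (by
        apply Measurable.aestronglyMeasurable
        fun_prop) (ae_of_all _ fun x => ?_)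
    have h1 := hkr x
    have h2 := hk0 x
    have h3 := hkδ x
    have h4 := coord_le x i
    set k := (‖x‖ ^ 2 + δ)⁻¹
    set r := ‖x‖
    rw [Real.norm_eq_abs, abs_mul, abs_of_nonneg (show 0 ≤ u x ^ 2 * k by positivity), mul_assoc]
    refine mul_le_mul_of_nonneg_left ?_ (sq_nonneg _)
    have : k * |x i| ≤ k * (1 + r ^ 2) := mul_le_mul_of_nonneg_left (by nlinarith [sq_nonneg (r - 1)]) h2.le
    nlinarith
  · intro i
    refine ((hu2.mul_const ((4 * δ⁻¹))).add hg).mono' (by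
        apply Measurable.aestronglyMeasurable
        simp only [PiLp.add_apply, PiLp.smul_apply]
        have := hmgi i
        fun_prop) (ae_of_all _ fun x => ?_)
    have h1 := hkr x
    have h2 := hk0 x
    have h3 := hkδ x
    have h4 := coord_sq_le x i
    have h5 := coord_sq_le (gradient u x) i
    simp [-inv_pow]
    set k := (‖x‖ ^ 2 + δ)⁻¹
    set a := ‖gradient u x‖
    set g := gradient u x i
    set r := ‖x‖
    set y := x i
    have e1 : |2 * u x * (y * g)| ≤ (u x ^ 2 + r ^ 2 * a ^ 2) := by
      have hq : (y * g) ^ 2 ≤ r ^ 2 * a ^ 2 := by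
        rw [mul_pow]; exact mul_le_mul h4 h5 (sq_nonneg _) (sq_nonneg _)
      rw [abs_le]; constructor
      · nlinarith [sq_nonneg (u x + y * g)]
      · nlinarith [sq_nonneg (u x - y * g)]
    have e5 : 0 ≤ u x ^ 2 * k := by positivity
    have e2 : |k * (2 * u x * (y * g))| ≤ (u x ^ 2 * k) + a ^ 2 := by
      rw [abs_mul, abs_of_pos h2]
      have := mul_le_mul_of_nonneg_left e1 h2.le
      have h3 := mul_le_mul_of_nonneg_right h1 (sq_nonneg a)
      nlinarith
    have e3 : u x ^ 2 * (k ^ 2 * (2 * y ^ 2)) ≤ 2 * (u x ^ 2 * k) := by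
      have h3 := mul_le_mul_of_nonneg_left h1 (show 0 ≤ 2 * (u x ^ 2 * k) by positivity)
      have h6 := mul_le_mul_of_nonneg_left h4 (show 0 ≤ 2 * (u x ^ 2 * k ^ 2) by positivity)
      nlinarith
    have e4 : 0 ≤ u x ^ 2 * (k ^ 2 * (2 * y ^ 2)) := by positivity
    have e6 : u x ^ 2 * k ≤ u x ^ 2 * δ⁻¹ := mul_le_mul_of_nonneg_left h3 (sq_nonneg _)
    have := abs_le.1 e2
    rw [abs_le]
    constructor <;> nlinarith

lemma hardy (hN : 4 ≤ N) {u : Euc N → ℝ} (hu : MemH1 u) :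
    Integrable (fun x => u x ^ 2 / ‖x‖ ^ 2) ∧
    ∫ x, u x ^ 2 / ‖x‖ ^ 2 ≤ ∫ x, ‖gradient u x‖ ^ 2 := by
  have hpos : ∀ k : ℕ, (0:ℝ) < 1 / ((k:ℝ) + 1) := fun k => by positivity
  have : Nonempty (Fin N) := ⟨⟨0, by omega⟩⟩
  refine fatou_int (f := fun k x => u x ^ 2 * (‖x‖ ^ 2 + 1 / ((k:ℝ) + 1))⁻¹)
    (fun k => (hardy_aux hN hu (hpos k)).1) (fun k x => by positivity)
    (fun k => (hardy_aux hN hu (hpos k)).2) ?_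
  have : ∀ᵐ x : Euc N, x ≠ 0 := by simp [ae_iff, measure_singleton]
  filter_upwards [this] with x hx
  rw [div_eq_mul_inv]
  refine Tendsto.const_mul _ (Tendsto.inv₀ ?_ (by simpa using hx))
  simpa using (tendsto_one_div_add_atTop_nhds_zero_nat (𝕜 := ℝ)).const_add (‖x‖ ^ 2)

lemma beta1_le (hN : 4 ≤ N) {u : Euc N → ℝ} (hu : MemH1 u) (h0 : 0 < ∫ x, u x ^ 2 / ‖x‖ ^ 2) :
    1 ≤ beta1 N ∧ beta1 N * ∫ x, u x ^ 2 / ‖x‖ ^ 2 ≤ (∫ x, ‖gradient u x‖ ^ 2) + ∫ x, u x ^ 2 := by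
  have hb : ∀ q ∈ { q : ℝ | ∃ u : Euc N → ℝ, MemH1 u ∧
    (0 < ∫ x : Euc N, u x ^ 2 / ‖x‖ ^ 2) ∧
    q = ((∫ x : Euc N, ‖gradient u x‖ ^ 2) + ∫ x : Euc N, u x ^ 2) /
        (∫ x : Euc N, u x ^ 2 / ‖x‖ ^ 2) }, 1 ≤ q := by
    rintro q ⟨v, hv, hv0, rfl⟩
    rw [le_div_iff₀ hv0, one_mul]
    have := (hardy hN hv).2
    have h2 : 0 ≤ ∫ x, v x ^ 2 := integral_nonneg fun x => sq_nonneg _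
    linarith
  have hmem : ((∫ x : Euc N, ‖gradient u x‖ ^ 2) + ∫ x : Euc N, u x ^ 2) /
        (∫ x : Euc N, u x ^ 2 / ‖x‖ ^ 2) ∈ { q : ℝ | ∃ u : Euc N → ℝ, MemH1 u ∧
    (0 < ∫ x : Euc N, u x ^ 2 / ‖x‖ ^ 2) ∧
    q = ((∫ x : Euc N, ‖gradient u x‖ ^ 2) + ∫ x : Euc N, u x ^ 2) /
        (∫ x : Euc N, u x ^ 2 / ‖x‖ ^ 2) } := ⟨u, hu, h0, rfl⟩
  refine ⟨le_csInf ⟨_, hmem⟩ hb, ?_⟩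
  rw [← le_div_iff₀ h0]
  exact csInf_le ⟨1, hb⟩ hmem

def hcut (y : ℝ) : ℝ := Real.smoothTransition (2 - y)

lemma hcut_contDiff : ContDiff ℝ 1 hcut := by
  have h : ContDiff ℝ 1 Real.smoothTransition := Real.smoothTransition.contDiff (n := 1)
  exact h.comp (contDiff_const.sub contDiff_id)

lemma hcut_nonneg (y : ℝ) : 0 ≤ hcut y := Real.smoothTransition.nonneg _
lemma hcut_le_one (y : ℝ) : hcut y ≤ 1 := Real.smoothTransition.le_one _
lemma hcut_one {y : ℝ} (h : y ≤ 1) : hcut y = 1 :=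
  Real.smoothTransition.one_of_one_le (by linarith)
lemma hcut_zero {y : ℝ} (h : 2 ≤ y) : hcut y = 0 :=
  Real.smoothTransition.zero_of_nonpos (by linarith)

lemma hcut_deriv (y : ℝ) : HasDerivAt hcut (deriv hcut y) y :=
  (hcut_contDiff.differentiable (by norm_num) y).hasDerivAt

lemma hcut_deriv_cont : Continuous (deriv hcut) := hcut_contDiff.continuous_deriv le_rfl

lemma hcut_deriv_lo {y : ℝ} (h : y < 1) : deriv hcut y = 0 := by
  have : hcut =ᶠ[𝓝 y] fun _ => 1 := by
    filter_upwards [Iio_mem_nhds h] with z hz using hcut_one (le_of_lt hz)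
  rw [this.deriv_eq]; simp

lemma hcut_deriv_hi {y : ℝ} (h : 2 < y) : deriv hcut y = 0 := by
  have : hcut =ᶠ[𝓝 y] fun _ => 0 := by
    filter_upwards [Ioi_mem_nhds h] with z hz using hcut_zero (le_of_lt hz)
  rw [this.deriv_eq]; simp

lemma hcut_deriv_bdd : ∃ C, 0 ≤ C ∧ ∀ y, |deriv hcut y| ≤ C := by
  obtain ⟨C, hC⟩ := (isCompact_Icc (a := (1:ℝ)) (b := 2)).exists_bound_of_continuousOn
    hcut_deriv_cont.continuousOn
  refine ⟨C, (norm_nonneg _).trans (hC 1 (by norm_num)), fun y => ?_⟩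
  by_cases h : y ∈ Icc (1:ℝ) 2
  · exact hC y h
  · have h0 : deriv hcut y = 0 := by
      rw [mem_Icc, not_and_or, not_le, not_le] at h
      rcases h with h | h
      · exact hcut_deriv_lo h
      · exact hcut_deriv_hi h
    rw [h0, abs_zero]
    exact (norm_nonneg _).trans (hC 1 (by norm_num))

/-- gradient of the cutoff -/
lemma hg_eta (c : ℝ) (x : Euc N) : HasGradientAt (fun y : Euc N => hcut (c * ‖y‖ ^ 2))
    ((deriv hcut (c * ‖x‖ ^ 2)) • (c • ((2:ℝ) • x))) x :=
  hg_comp (f := fun y : Euc N => c * ‖y‖ ^ 2) (hcut_deriv _) (hg_smul c (hg_nsq x))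

lemma eta_out {c : ℝ} (hc : 0 < c) (x : Euc N) (hx : 2 / c + 1 < ‖x‖) : hcut (c * ‖x‖ ^ 2) = 0 := by
  apply hcut_zero
  have h1 : 2 < c * ‖x‖ := by
    have : 2 / c < ‖x‖ := by linarith
    rw [div_lt_iff₀ hc] at this; linarith
  have h2 : 1 ≤ ‖x‖ := by have : 0 < 2 / c := by positivity
                          linarith
  nlinarith

lemma grad_coord (u : Euc N → ℝ) (x : Euc N) (i : Fin N) :
    gradient u x i = fderiv ℝ u x (EuclideanSpace.single i 1) := by
  have h := inner_gradient_left (𝕜 := ℝ) (f := u) (x := x) (y := EuclideanSpace.single i 1)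
  rw [← h, EuclideanSpace.inner_single_right]
  simp

lemma grad_cont {u : Euc N → ℝ} (hu : ContDiff ℝ 2 u) : Continuous (gradient u) :=
  (InnerProductSpace.toDual ℝ (Euc N)).symm.continuous.comp (hu.continuous_fderiv (by norm_num))

lemma grad2 {u : Euc N → ℝ} (hu : ContDiff ℝ 2 u) (i : Fin N) (x : Euc N) :
    ∃ g : Euc N, HasGradientAt (fun y => gradient u y i) g x ∧
    g i = iteratedFDeriv ℝ 2 u x ![EuclideanSpace.single i 1, EuclideanSpace.single i 1] := by
  have h1 : ContDiff ℝ 1 (fderiv ℝ u) := hu.fderiv_right (by norm_num)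
  have h2 : HasFDerivAt (fderiv ℝ u) (fderiv ℝ (fderiv ℝ u) x) x :=
    (h1.differentiable (by norm_num) x).hasFDerivAt
  have h3 : HasFDerivAt (fun y => gradient u y i)
      ((fderiv ℝ (fderiv ℝ u) x).flip (EuclideanSpace.single i 1)) x := by
    simp only [grad_coord]
    have h4 := h2.clm_apply (hasFDerivAt_const (EuclideanSpace.single i (1:ℝ) : Euc N) x)
    simpa using h4
  refine ⟨_, h3.differentiableAt.hasGradientAt, ?_⟩
  rw [grad_coord, h3.fderiv, iteratedFDeriv_two_apply]
  simp

lemma lap_cont_i {u : Euc N → ℝ} (hu : ContDiff ℝ 2 u) (i : Fin N) : Continuous fun x =>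
    iteratedFDeriv ℝ 2 u x ![EuclideanSpace.single i 1, EuclideanSpace.single i 1] := by
  have h1 : ContDiff ℝ 1 (fderiv ℝ u) := hu.fderiv_right (by norm_num)
  have h2 := h1.continuous_fderiv (by norm_num)
  simp only [iteratedFDeriv_two_apply]
  fun_prop

lemma nehari {u : Euc N → ℝ} (hu : MemH1 u) (hC2 : ContDiff ℝ 2 u) (hpos : ∀ x, 0 < u x)
    {α p : ℝ} (hα : 0 < α) (heq : ∀ x, - lap u x + u x = ‖x‖ ^ α * u x ^ (p - 1)) :
    Integrable (fun x => ‖x‖ ^ α * u x ^ p) ∧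
    ∫ x, ‖x‖ ^ α * u x ^ p = ∫ x, (‖gradient u x‖ ^ 2 + u x ^ 2) := by
  obtain ⟨huc, hud, hg, hu2⟩ := hu
  have hgc := grad_cont hC2
  obtain ⟨C, hC0, hC⟩ := hcut_deriv_bdd
  have hA : Integrable (fun x => ‖gradient u x‖ ^ 2 + u x ^ 2) := hg.add hu2
  choose G hG hGi using fun i x => grad2 hC2 i x
  have hρc : Continuous (fun x => ‖x‖ ^ α * u x ^ p) := by
    refine Continuous.mul (continuous_norm.rpow_const fun x => Or.inr hα.le) ?_
    exact huc.rpow_const fun x => Or.inl (hpos x).ne'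
  have hc : ∀ k : ℕ, (0:ℝ) < 1 / ((k:ℝ) + 1) := fun k => by positivity
  have hc1 : ∀ k : ℕ, 1 / ((k:ℝ) + 1) ≤ 1 := fun k => by
    rw [div_le_one (by positivity)]; linarith [k.cast_nonneg (α := ℝ)]
  have hhc := hcut_contDiff.continuous
  have hhd := hcut_deriv_cont
  set R : ℕ → Euc N → ℝ := fun k x => hcut (1 / ((k:ℝ) + 1) * ‖x‖ ^ 2) * (‖gradient u x‖ ^ 2 + u x ^ 2)
    + u x * (deriv hcut (1 / ((k:ℝ) + 1) * ‖x‖ ^ 2) * (1 / ((k:ℝ) + 1) * (2 * inner ℝ x (gradient u x)))) with hR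
  set S : ℕ → Euc N → ℝ := fun k x => hcut (1 / ((k:ℝ) + 1) * ‖x‖ ^ 2) * (‖x‖ ^ α * u x ^ p) with hS
  have iS : ∀ k, Integrable (S k) := fun k => by
    refine integrable_of_out (R := 2 / (1 / ((k:ℝ) + 1)) + 1) (by fun_prop) fun x hx => ?_
    simp only [hS, eta_out (hc k) x hx, zero_mul]
  have hRb : ∀ k x, ‖R k x‖ ≤ (1 + 4 * C) * (‖gradient u x‖ ^ 2 + u x ^ 2) := by
    intro k x
    simp only [hR]
    have hck := hc k
    have hck1 := hc1 k
    set c := 1 / ((k:ℝ) + 1)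
    have h1 := hcut_nonneg (c * ‖x‖ ^ 2)
    have h2 := hcut_le_one (c * ‖x‖ ^ 2)
    have h3 : |u x * (deriv hcut (c * ‖x‖ ^ 2) * (c * (2 * inner ℝ x (gradient u x))))|
        ≤ 4 * C * (‖gradient u x‖ ^ 2 + u x ^ 2) := by
      by_cases h : c * ‖x‖ ^ 2 ≤ 2
      · have h4 : c * ‖x‖ ≤ 2 := by
          have : (c * ‖x‖) ^ 2 ≤ 2 ^ 2 := by
            have : c * (c * ‖x‖ ^ 2) ≤ 1 * 2 := mul_le_mul hck1 h (by positivity) (by norm_num)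
            nlinarith
          exact (abs_le_of_sq_le_sq' this (by norm_num)).2
        have h5 := abs_real_inner_le_norm x (gradient u x)
        rw [abs_mul, abs_mul, abs_mul, abs_mul, abs_of_pos hck, abs_two]
        have h6 : c * (2 * |inner ℝ x (gradient u x)|) ≤ 4 * ‖gradient u x‖ := by
          have := mul_le_mul_of_nonneg_right h4 (norm_nonneg (gradient u x))
          have := mul_le_mul_of_nonneg_left h5 hck.le
          nlinarith
        calc |u x| * (|deriv hcut (c * ‖x‖ ^ 2)| * (c * (2 * |inner ℝ x (gradient u x)|)))
            ≤ |u x| * (C * (4 * ‖gradient u x‖)) := by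
              gcongr; exact hC _
          _ ≤ _ := by
            have : |u x| * ‖gradient u x‖ ≤ ‖gradient u x‖ ^ 2 + u x ^ 2 := by
              rw [← sq_abs (u x)]
              nlinarith [sq_nonneg (|u x| - ‖gradient u x‖), sq_nonneg (|u x|), sq_nonneg (‖gradient u x‖)]
            nlinarith
      · rw [hcut_deriv_hi (not_le.1 h)]
        simp; positivity
    have h0 : 0 ≤ ‖gradient u x‖ ^ 2 + u x ^ 2 := by positivity
    rw [Real.norm_eq_abs]
    refine (abs_add_le _ _).trans ?_
    rw [abs_of_nonneg (mul_nonneg h1 h0)]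
    nlinarith
  have hRc : ∀ k, Continuous (R k) := fun k => by
    simp only [hR]; fun_prop
  have iR : ∀ k, Integrable (R k) := fun k =>
    (hA.const_mul (1 + 4 * C)).mono' (hRc k).aestronglyMeasurable (ae_of_all _ (hRb k))
  have hev : ∀ x : Euc N, ∀ᶠ k : ℕ in atTop, 1 / ((k:ℝ) + 1) * ‖x‖ ^ 2 < 1 := fun x => by
    have := (tendsto_one_div_add_atTop_nhds_zero_nat (𝕜 := ℝ)).mul_const (‖x‖ ^ 2)
    rw [zero_mul] at this
    exact this.eventually (Iio_mem_nhds one_pos)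
  have hRS : ∀ k, ∫ x, S k x = ∫ x, R k x := by
    intro k
    have key := int_div_cpt (fun x => hcut (1 / ((k:ℝ) + 1) * ‖x‖ ^ 2) * u x) _ (gradient u) G
      (fun x => hg_mul (hg_eta _ x) (hud x).hasGradientAt) hG (by fun_prop) hgc
      (fun i => by simp only [hGi]; exact lap_cont_i hC2 i)
      (R := 2 / (1 / ((k:ℝ) + 1)) + 1) (fun x hx => by simp only [eta_out (hc k) x hx, zero_mul])
    have : ∫ x, (R k x - S k x) = 0 := by
      rw [← key]
      congr 1; ext x
      have hl : ∑ i, (G i x) i = u x - ‖x‖ ^ α * u x ^ (p - 1) := by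
        have := heq x
        unfold lap at this
        simp only [hGi]; linarith
      rw [hl]
      have hp : u x ^ p = u x ^ (p - 1) * u x := by
        rw [← Real.rpow_add_one (hpos x).ne']; simp
      simp only [hR, hS, hp, inner_add_left, inner_smul_left, real_inner_self_eq_norm_sq, conj_trivial]
      ring
    rw [integral_sub (iR k) (iS k)] at this
    linarith
  have hSt : ∀ᵐ x, Tendsto (fun k => S k x) atTop (𝓝 (‖x‖ ^ α * u x ^ p)) := by
    refine ae_of_all _ fun x => tendsto_const_nhds.congr' ?_
    filter_upwards [hev x] with k hk
    simp only [hS, hcut_one hk.le, one_mul]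
  have hRt : ∀ᵐ x, Tendsto (fun k => R k x) atTop (𝓝 (‖gradient u x‖ ^ 2 + u x ^ 2)) := by
    refine ae_of_all _ fun x => tendsto_const_nhds.congr' ?_
    filter_upwards [hev x] with k hk
    simp only [hR, hcut_one hk.le, hcut_deriv_lo hk]; ring
  have hρ0 : ∀ x, 0 ≤ ‖x‖ ^ α * u x ^ p := fun x =>
    mul_nonneg (Real.rpow_nonneg (norm_nonneg _) _) (Real.rpow_nonneg (hpos x).le _)
  have hI := fatou_int (C := ∫ x, (1 + 4 * C) * (‖gradient u x‖ ^ 2 + u x ^ 2)) iS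
    (fun k x => mul_nonneg (hcut_nonneg _) (hρ0 x)) (fun k => by
      rw [hRS]
      exact integral_mono (iR k) (hA.const_mul _) fun x => (le_abs_self _).trans (hRb k x)) hSt
  refine ⟨hI.1, ?_⟩
  have t1 := tendsto_integral_of_dominated_convergence _ (fun k => (iS k).1) hI.1
    (fun k => ae_of_all _ fun x => by
      rw [Real.norm_of_nonneg (mul_nonneg (hcut_nonneg _) (hρ0 x))]
      exact mul_le_of_le_one_left (hρ0 x) (hcut_le_one _)) hSt
  have t2 := tendsto_integral_of_dominated_convergence _ (fun k => (iR k).1)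
    (hA.const_mul (1 + 4 * C)) (fun k => ae_of_all _ (hRb k)) hRt
  simp only [hRS] at t1
  exact tendsto_nhds_unique t1 t2

lemma polar_M (hN : 0 < N) : ∃ M : (Euc N → ℝ) → ℝ, ∀ (F : ℝ → ℝ) (h : Euc N → ℝ),
    (∀ c : ℝ, 0 < c → ∀ x, h (c • x) = h x) →
    ∫ x : Euc N, F ‖x‖ * h x = M h * ∫ x : Euc N, F ‖x‖ := by
  have : Nonempty (Fin N) := ⟨⟨0, hN⟩⟩
  have hp : ∀ (F : ℝ → ℝ) (h : Euc N → ℝ), (∀ c : ℝ, 0 < c → ∀ x, h (c • x) = h x) →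
      ∫ x : Euc N, F ‖x‖ * h x = (∫ ω : Metric.sphere (0 : Euc N) 1, h ω ∂(volume : Measure (Euc N)).toSphere) *
        ∫ r : Ioi (0:ℝ), F r ∂(Measure.volumeIoiPow (Module.finrank ℝ (Euc N) - 1)) := by
    intro F h hh
    rw [← integral_prod_mul]
    have e1 : ∫ x : Euc N, F ‖x‖ * h x = ∫ x : ({(0 : Euc N)}ᶜ : Set (Euc N)), F ‖x.1‖ * h x.1
        ∂((volume : Measure (Euc N)).comap (↑)) := by
      rw [integral_subtype_comap (measurableSet_singleton _).compl fun x : Euc N ↦ F ‖x‖ * h x,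
        restrict_compl_singleton]
    rw [e1, ← (volume : Measure (Euc N)).measurePreserving_homeomorphUnitSphereProd.integral_comp
        (Homeomorph.measurableEmbedding _)]
    congr 1; ext x
    have hx : x.1 ≠ 0 := x.2
    simp only [homeomorphUnitSphereProd_apply_snd_coe, homeomorphUnitSphereProd_apply_fst_coe]
    rw [hh _ (inv_pos.2 (norm_pos_iff.2 hx)), mul_comm]
  refine ⟨fun h => (∫ ω : Metric.sphere (0 : Euc N) 1, h ω ∂(volume : Measure (Euc N)).toSphere) /
    (volume : Measure (Euc N)).toSphere.real univ, fun F h hh => ?_⟩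
  have h1 := hp F (fun _ => 1) (fun _ _ _ => rfl)
  simp only [mul_one] at h1
  have hne : (volume : Measure (Euc N)).toSphere.real univ ≠ 0 := by
    have : (volume : Measure (Euc N)).toSphere ≠ 0 := Measure.toSphere_ne_zero _
    rw [Measure.real, ENNReal.toReal_ne_zero]
    exact ⟨Measure.measure_univ_ne_zero.2 this, measure_ne_top _ _⟩
  rw [hp F h hh, h1, integral_const, smul_eq_mul, mul_one]
  field_simp

def sg (n : ℕ) (i : Fin N) : ℝ := if (i : ℕ) < n then 1 else -1

lemma sg_sq (n : ℕ) (i : Fin N) : sg n i ^ 2 = 1 := by unfold sg; split_ifs <;> norm_num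

lemma sg_sum {n : ℕ} (hN : N = 2 * n) : ∑ i : Fin N, sg n i = 0 := by
  subst hN
  unfold sg
  rw [Fin.sum_univ_eq_sum_range (fun i => if i < n then (1:ℝ) else -1) (2 * n), two_mul,
    Finset.sum_range_add]
  have h1 : ∑ i ∈ Finset.range n, (if i < n then (1:ℝ) else -1) = n := by
    rw [Finset.sum_congr rfl (g := fun _ => (1:ℝ))]
    · simp
    · intro i hi; simp [Finset.mem_range.1 hi]
  rw [h1]; simp

def DD (n : ℕ) (x : Euc N) : ℝ := ∑ i, sg n i * x i ^ 2
def JJ (n : ℕ) (x : Euc N) : Euc N := WithLp.toLp 2 fun i => sg n i * x i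
def PP (n : ℕ) (x : Euc N) : ℝ := (‖x‖ ^ 2) ^ 2 - (n + 1) * DD n x ^ 2
def gPP (n : ℕ) (x : Euc N) : Euc N := (4 * ‖x‖ ^ 2) • x - (4 * (n + 1) * DD n x) • JJ n x

@[simp] lemma JJ_apply (n : ℕ) (x : Euc N) (i : Fin N) : JJ n x i = sg n i * x i := rfl

lemma nsq (x : Euc N) : ‖x‖ ^ 2 = ∑ i, x i ^ 2 := by
  rw [EuclideanSpace.norm_sq_eq]; simp

lemma inner_JJ (n : ℕ) (x : Euc N) : inner ℝ (JJ n x) x = DD n x := by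
  simp only [PiLp.inner_apply, JJ_apply, DD]
  refine Finset.sum_congr rfl fun i _ => ?_
  simp; ring

lemma inner_JJ' (n : ℕ) (x : Euc N) : inner ℝ x (JJ n x) = DD n x := by
  rw [real_inner_comm, inner_JJ]

lemma norm_JJ (n : ℕ) (x : Euc N) : ‖JJ n x‖ ^ 2 = ‖x‖ ^ 2 := by
  rw [nsq, nsq]
  refine Finset.sum_congr rfl fun i _ => ?_
  rw [JJ_apply, mul_pow, sg_sq, one_mul]

lemma DD_abs (n : ℕ) (x : Euc N) : |DD n x| ≤ ‖x‖ ^ 2 := by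
  rw [← inner_JJ]
  refine (abs_real_inner_le_norm _ _).trans ?_
  have : ‖JJ n x‖ = ‖x‖ := by
    have := norm_JJ n x
    rwa [sq_eq_sq₀ (norm_nonneg _) (norm_nonneg _)] at this
  rw [this, sq]

lemma DD_cont (n : ℕ) : Continuous (DD n : Euc N → ℝ) := by unfold DD; fun_prop
lemma JJ_cont (n : ℕ) : Continuous (JJ n : Euc N → Euc N) := by
  unfold JJ
  refine (PiLp.continuous_toLp 2 _).comp ?_
  fun_prop
lemma PP_cont (n : ℕ) : Continuous (PP n : Euc N → ℝ) := by
  have := DD_cont (N := N) n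
  unfold PP; fun_prop
lemma gPP_cont (n : ℕ) : Continuous (gPP n : Euc N → Euc N) := by
  have := DD_cont (N := N) n
  have := JJ_cont (N := N) n
  unfold gPP; fun_prop

lemma hg_DD (n : ℕ) (x : Euc N) : HasGradientAt (DD n) ((2:ℝ) • JJ n x) x := by
  have h : ∀ i ∈ Finset.univ, HasGradientAt (fun y : Euc N => sg n i * y i ^ 2)
      (sg n i • ((2 * x i) • EuclideanSpace.single i (1:ℝ))) x := fun i _ => by
    have := hg_comp (hasDerivAt_pow 2 (x i)) (hg_coord i x)
    simpa using hg_smul (sg n i) this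
  have h2 := hg_sum Finset.univ h
  have e : ∑ i, sg n i • ((2 * x i) • EuclideanSpace.single i (1:ℝ)) = (2:ℝ) • JJ n x := by
    ext j
    simp [Finset.sum_apply, Pi.single_apply, Finset.sum_ite_eq]
    ring
  rw [e] at h2
  exact h2

lemma hg_PP (n : ℕ) (x : Euc N) : HasGradientAt (PP n) (gPP n x) x := by
  have h1 := hg_comp (f := fun y : Euc N => ‖y‖ ^ 2) (hasDerivAt_pow 2 (‖x‖ ^ 2)) (hg_nsq x)
  have h2 := hg_smul (-((n:ℝ) + 1)) (hg_comp (hasDerivAt_pow 2 (DD n x)) (hg_DD n x))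
  have h3 := hg_add h1 h2
  have e : gPP n x = (((2:ℕ):ℝ) * (‖x‖ ^ 2) ^ (2 - 1)) • (2:ℝ) • x +
    (-((n:ℝ) + 1)) • (((2:ℕ):ℝ) * (DD n x) ^ (2 - 1)) • (2:ℝ) • JJ n x := by
    ext j
    simp [gPP]; ring
  rw [e]
  convert h3 using 2
  simp [PP]; ring

lemma gPP_inner (n : ℕ) (x : Euc N) : inner ℝ (gPP n x) x = 4 * PP n x := by
  simp only [gPP, inner_sub_left, inner_smul_left, inner_JJ, real_inner_self_eq_norm_sq, conj_trivial, PP]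
  ring

lemma gPP_inner' (n : ℕ) (x : Euc N) : inner ℝ x (gPP n x) = 4 * PP n x := by
  rw [real_inner_comm, gPP_inner]

lemma gPP_sq (n : ℕ) (x : Euc N) : ‖gPP n x‖ ^ 2 =
    16 * (‖x‖ ^ 2) ^ 3 - 32 * (n + 1) * ‖x‖ ^ 2 * DD n x ^ 2
      + 16 * (n + 1) ^ 2 * DD n x ^ 2 * ‖x‖ ^ 2 := by
  rw [← real_inner_self_eq_norm_sq]
  simp only [gPP, inner_sub_left, inner_sub_right, inner_smul_left, inner_smul_right, inner_JJ, inner_JJ',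
    real_inner_self_eq_norm_sq, conj_trivial, norm_JJ]
  ring

lemma hg_gPP (n : ℕ) (i : Fin N) (x : Euc N) : HasGradientAt (fun y => gPP n y i)
    ((4 * ‖x‖ ^ 2 + (-4 * (n + 1) * sg n i) * DD n x) • EuclideanSpace.single i (1:ℝ) +
      x i • ((4:ℝ) • (2:ℝ) • x + (-4 * (n + 1) * sg n i) • (2:ℝ) • JJ n x)) x := by
  have h := hg_mul (hg_add (hg_smul 4 (hg_nsq x)) (hg_smul (-4 * (n + 1) * sg n i) (hg_DD n x)))
    (hg_coord i x)
  convert h using 2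
  simp [gPP]; ring

lemma div_gPP {n : ℕ} (hN : N = 2 * n) (x : Euc N) :
    ∑ i, ((4 * ‖x‖ ^ 2 + (-4 * (n + 1) * sg n i) * DD n x) • EuclideanSpace.single i (1:ℝ) +
      x i • ((4:ℝ) • (2:ℝ) • x + (-4 * (n + 1) * sg n i) • (2:ℝ) • JJ n x) : Euc N) i = 0 := by
  have e : ∀ i : Fin N, ((4 * ‖x‖ ^ 2 + (-4 * (n + 1) * sg n i) * DD n x) • EuclideanSpace.single i (1:ℝ) +
      x i • ((4:ℝ) • (2:ℝ) • x + (-4 * (n + 1) * sg n i) • (2:ℝ) • JJ n x) : Euc N) i =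
      4 * ‖x‖ ^ 2 + (-4 * (n + 1) * DD n x) * sg n i + (8 - 8 * (n + 1)) * x i ^ 2 := fun i => by
    have := sg_sq n i
    simp
    linear_combination (- 8 * (n + 1) * x i ^ 2) * this
  simp only [e, Finset.sum_add_distrib, ← Finset.mul_sum, sg_sum hN, ← nsq]
  simp [hN]; ring

lemma eta_out1 (x : Euc N) (hx : 3 < ‖x‖) : hcut (‖x‖ ^ 2) = 0 := by
  apply hcut_zero; nlinarith

lemma hg_eta1 (x : Euc N) : HasGradientAt (fun y : Euc N => hcut (‖y‖ ^ 2))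
    ((deriv hcut (‖x‖ ^ 2)) • ((2:ℝ) • x)) x :=
  hg_comp (f := fun y : Euc N => ‖y‖ ^ 2) (hcut_deriv _) (hg_nsq x)

lemma rad_id (k : ℕ) : ∫ x : Euc N, (hcut (‖x‖ ^ 2) * ((N + 2 * k) * (‖x‖ ^ 2) ^ k)
    + 2 * deriv hcut (‖x‖ ^ 2) * (‖x‖ ^ 2) ^ (k + 1)) = 0 := by
  have hhc := hcut_contDiff.continuous
  have hhd := hcut_deriv_cont
  have key := int_div_cpt (fun x : Euc N => hcut (‖x‖ ^ 2) * (‖x‖ ^ 2) ^ k) _ (fun x => x)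
    (fun i _ => EuclideanSpace.single i (1:ℝ))
    (fun x => hg_mul (hg_eta1 x) (hg_comp (f := fun y : Euc N => ‖y‖ ^ 2) (hasDerivAt_pow k (‖x‖ ^ 2)) (hg_nsq x)))
    (fun i x => hg_coord i x) (by fun_prop) continuous_id (fun i => continuous_const) (R := 3)
    (fun x hx => by simp only [eta_out1 x hx, zero_mul])
  rw [← key]
  congr 1; ext x
  simp only [inner_add_left, inner_smul_left, real_inner_self_eq_norm_sq, conj_trivial]
  rcases k with _ | k
  · simp; ring
  · simp; ring

lemma int_hcut_pos {f : Euc N → ℝ} (hf : Continuous f) (h0 : ∀ x, 0 ≤ f x) (x : Euc N)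
    (hx : ‖x‖ = 1) (hfx : f x ≠ 0) : 0 < ∫ x, hcut (‖x‖ ^ 2) * f x := by
  have hhc := hcut_contDiff.continuous
  refine Continuous.integral_pos_of_hasCompactSupport_nonneg_nonzero (x := x) (by fun_prop) ?_ ?_ ?_
  · apply HasCompactSupport.intro (isCompact_closedBall (0 : Euc N) 3)
    intro x hx
    rw [eta_out1 x (by simpa using hx), zero_mul]
  · intro x; exact mul_nonneg (hcut_nonneg _) (h0 x)
  · simp only [hx]
    rw [hcut_one (by norm_num)]; simpa using hfx

def psi (n : ℕ) (x : Euc N) : ℝ := 1 - (n + 1) * (DD n x ^ 2 / (‖x‖ ^ 2) ^ 2)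
def kap (n : ℕ) (x : Euc N) : ℝ :=
  16 * (n + 1) ^ 2 * ((DD n x ^ 2 / (‖x‖ ^ 2) ^ 2) * (1 - DD n x ^ 2 / (‖x‖ ^ 2) ^ 2))

lemma DD_smul (n : ℕ) (c : ℝ) (x : Euc N) : DD n (c • x) = c ^ 2 * DD n x := by
  simp only [DD, Finset.mul_sum]
  refine Finset.sum_congr rfl fun i _ => ?_
  simp; ring

lemma zeta_hom (n : ℕ) (c : ℝ) (hc : 0 < c) (x : Euc N) :
    DD n (c • x) ^ 2 / (‖c • x‖ ^ 2) ^ 2 = DD n x ^ 2 / (‖x‖ ^ 2) ^ 2 := by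
  rw [DD_smul, norm_smul, Real.norm_of_nonneg hc.le]
  have : (c ^ 2 * DD n x) ^ 2 / ((c * ‖x‖) ^ 2) ^ 2 = (c ^ 4 * DD n x ^ 2) / (c ^ 4 * (‖x‖ ^ 2) ^ 2) := by
    congr 1 <;> ring
  rw [this, mul_div_mul_left _ _ (by positivity)]

lemma psi_hom (n : ℕ) (c : ℝ) (hc : 0 < c) (x : Euc N) : psi n (c • x) = psi n x := by
  unfold psi; rw [zeta_hom n c hc]
lemma kap_hom (n : ℕ) (c : ℝ) (hc : 0 < c) (x : Euc N) : kap n (c • x) = kap n x := by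
  unfold kap; rw [zeta_hom n c hc]

lemma PP_psi (n : ℕ) (x : Euc N) : PP n x = (‖x‖ ^ 2) ^ 2 * psi n x := by
  rcases eq_or_ne x 0 with rfl | hx
  · simp [PP, DD]
  · have : ‖x‖ ≠ 0 := norm_ne_zero_iff.2 hx
    unfold PP psi; field_simp

lemma gPP_kap (n : ℕ) (x : Euc N) : ‖gPP n x‖ ^ 2 = (‖x‖ ^ 2) ^ 3 * (kap n x + 16 * psi n x ^ 2) := by
  rw [gPP_sq]
  rcases eq_or_ne x 0 with rfl | hx
  · simp
  · have : ‖x‖ ≠ 0 := norm_ne_zero_iff.2 hx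
    unfold kap psi; field_simp; ring

lemma sphere_facts {n : ℕ} (hn : 1 ≤ n) (hN : N = 2 * n) : ∃ b : ℝ, 0 < b ∧
    (∀ F : ℝ → ℝ, ∫ x : Euc N, F ‖x‖ * psi n x = 0) ∧
    (∀ F : ℝ → ℝ, ∫ x : Euc N, F ‖x‖ * psi n x ^ 2 = b * ∫ x : Euc N, F ‖x‖) ∧
    (∀ F : ℝ → ℝ, ∫ x : Euc N, F ‖x‖ * kap n x = 4 * (N + 2) * b * ∫ x : Euc N, F ‖x‖) := by
  obtain ⟨M, hM⟩ := polar_M (N := N) (by omega)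
  have hhc := hcut_contDiff.continuous
  have hhd := hcut_deriv_cont
  have hPc := PP_cont (N := N) n
  have hgc := gPP_cont (N := N) n
  let i0 : Fin N := ⟨0, by omega⟩
  let e0 : Euc N := EuclideanSpace.single i0 1
  have he0 : ‖e0‖ = 1 := by simp [e0]
  have hh1 := psi_hom (N := N) n
  have hh2 : ∀ c : ℝ, 0 < c → ∀ x : Euc N, psi n (c • x) ^ 2 = psi n x ^ 2 := fun c hc x => by
    rw [psi_hom n c hc]
  have hh3 := kap_hom (N := N) n
  -- basic integrability
  have iint : ∀ f : Euc N → ℝ, Continuous f → Integrable fun x => hcut (‖x‖ ^ 2) * f x := fun f hf =>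
    integrable_of_out (R := 3) (by fun_prop) fun x hx => by rw [eta_out1 x hx, zero_mul]
  have iint' : ∀ f : Euc N → ℝ, Continuous f → Integrable fun x => deriv hcut (‖x‖ ^ 2) * f x := fun f hf =>
    integrable_of_out (R := 3) (by fun_prop) fun x hx => by
      rw [hcut_deriv_hi (by nlinarith), zero_mul]
  have rad : ∀ k : ℕ, (N + 2 * k) * (∫ x : Euc N, hcut (‖x‖ ^ 2) * (‖x‖ ^ 2) ^ k) =
      - 2 * ∫ x : Euc N, deriv hcut (‖x‖ ^ 2) * (‖x‖ ^ 2) ^ (k + 1) := fun k => by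
    have h := rad_id (N := N) k
    have e : (fun x : Euc N => (hcut (‖x‖ ^ 2) * ((N + 2 * k) * (‖x‖ ^ 2) ^ k)
      + 2 * deriv hcut (‖x‖ ^ 2) * (‖x‖ ^ 2) ^ (k + 1))) = fun x : Euc N =>
      (N + 2 * k) * (hcut (‖x‖ ^ 2) * (‖x‖ ^ 2) ^ k) + 2 * (deriv hcut (‖x‖ ^ 2) * (‖x‖ ^ 2) ^ (k + 1)) := by
      ext x; ring
    rw [e, integral_add ((iint _ (by fun_prop)).const_mul _) ((iint' _ (by fun_prop)).const_mul _),
      integral_const_mul, integral_const_mul] at h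
    linarith
  have radpos : ∀ k : ℕ, 0 < ∫ x : Euc N, hcut (‖x‖ ^ 2) * (‖x‖ ^ 2) ^ k := fun k =>
    int_hcut_pos (by fun_prop) (fun x => by positivity) e0 he0 (by simp [he0])
  -- psi average zero
  have k1 := int_div_cpt (fun x : Euc N => hcut (‖x‖ ^ 2)) _ (gPP n) _
    (fun x => hg_eta1 x) (fun i x => hg_gPP n i x) (by fun_prop) hgc
    (fun i => by
      have := DD_cont (N := N) n
      simp only [PiLp.add_apply, PiLp.smul_apply, JJ_apply]
      fun_prop) (R := 3)
    (fun x hx => by simp only [eta_out1 x hx])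
  simp only [div_gPP hN, inner_smul_left, gPP_inner', conj_trivial, mul_zero, zero_add] at k1
  have m1 : M (psi n) = 0 := by
    have h := hM (fun r => deriv hcut (r ^ 2) * (r ^ 2) ^ 2) (psi n) hh1
    have e : (fun x : Euc N => deriv hcut (‖x‖ ^ 2) * (2 * (4 * PP n x))) = fun x =>
        8 * (deriv hcut (‖x‖ ^ 2) * (‖x‖ ^ 2) ^ 2 * psi n x) := by
      ext x; rw [PP_psi]; ring
    rw [e, integral_const_mul, h] at k1
    have h1 := rad 1
    have h2 := radpos 1
    have h3 : (∫ x : Euc N, deriv hcut (‖x‖ ^ 2) * (‖x‖ ^ 2) ^ 2) ≠ 0 := by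
      intro h0
      rw [show 1 + 1 = 2 from rfl, h0] at h1
      have : 0 < ((N:ℝ) + 2 * (1:ℕ)) * (∫ x : Euc N, hcut (‖x‖ ^ 2) * (‖x‖ ^ 2) ^ 1) := by positivity
      linarith
    simpa [h3] using k1
  -- second identity
  have k2 := int_div_cpt (fun x : Euc N => hcut (‖x‖ ^ 2) * PP n x) _ (gPP n) _
    (fun x => hg_mul (hg_eta1 x) (hg_PP n x)) (fun i x => hg_gPP n i x) (by fun_prop) hgc
    (fun i => by
      have := DD_cont (N := N) n
      simp only [PiLp.add_apply, PiLp.smul_apply, JJ_apply]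
      fun_prop) (R := 3)
    (fun x hx => by simp only [eta_out1 x hx, zero_mul])
  simp only [div_gPP hN, inner_add_left, inner_smul_left, gPP_inner', real_inner_self_eq_norm_sq, conj_trivial, mul_zero, zero_add] at k2
  have hb : 0 < M (fun x => psi n x ^ 2) := by
    have h := hM (fun r => hcut (r ^ 2) * (r ^ 2) ^ 4) (fun x => psi n x ^ 2) hh2
    have h1 : 0 < ∫ x : Euc N, hcut (‖x‖ ^ 2) * PP n x ^ 2 :=
      int_hcut_pos (by fun_prop) (fun x => by positivity) e0 he0 (by
        have : DD n e0 = 1 := by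
          simp only [DD, e0, PiLp.single_apply]
          rw [Finset.sum_eq_single i0]
          · simp [sg, i0]; omega
          · intro j _ hj; simp [hj]
          · simp
        have hn' : (1:ℝ) ≤ n := by exact_mod_cast hn
        simp only [PP, this, he0]
        norm_num
        linarith)
    have e : (fun x : Euc N => hcut (‖x‖ ^ 2) * PP n x ^ 2) = fun x =>
        hcut (‖x‖ ^ 2) * (‖x‖ ^ 2) ^ 4 * psi n x ^ 2 := by
      ext x; rw [PP_psi]; ring
    rw [e, h] at h1
    exact (pos_iff_pos_of_mul_pos h1).2 (radpos 4)
  have m2 : M (kap n) = 4 * (N + 2) * M (fun x => psi n x ^ 2) := by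
    have hka := hM (fun r => hcut (r ^ 2) * (r ^ 2) ^ 3) _ hh3
    have hpa := hM (fun r => hcut (r ^ 2) * (r ^ 2) ^ 3) (fun x => psi n x ^ 2) hh2
    have hpb := hM (fun r => deriv hcut (r ^ 2) * (r ^ 2) ^ 4) (fun x => psi n x ^ 2) hh2
    have hcont : Integrable fun x : Euc N => hcut (‖x‖ ^ 2) * (‖x‖ ^ 2) ^ 3 * psi n x ^ 2 := by
      by_contra hni
      have h0 := integral_undef hni
      rw [hpa] at h0
      rcases mul_eq_zero.1 h0 with h | h
      · exact hb.ne' h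
      · exact (radpos 3).ne' h
    have hgi : Integrable fun x : Euc N => hcut (‖x‖ ^ 2) * ‖gPP n x‖ ^ 2 := iint _ (by fun_prop)
    have hki : Integrable fun x : Euc N => hcut (‖x‖ ^ 2) * (‖x‖ ^ 2) ^ 3 * kap n x := by
      refine (hgi.sub (hcont.const_mul 16)).congr (ae_of_all _ fun x => ?_)
      simp only [gPP_kap, Pi.sub_apply]; ring
    have hPi : Integrable fun x : Euc N => deriv hcut (‖x‖ ^ 2) * PP n x ^ 2 := iint' _ (by fun_prop)
    have hPi' : Integrable fun x : Euc N => deriv hcut (‖x‖ ^ 2) * (‖x‖ ^ 2) ^ 4 * psi n x ^ 2 := by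
      refine hPi.congr (ae_of_all _ fun x => ?_)
      simp only [PP_psi]; ring
    have e : ∀ x : Euc N, hcut (‖x‖ ^ 2) * ‖gPP n x‖ ^ 2 + PP n x * (deriv hcut (‖x‖ ^ 2) * (2 * (4 * PP n x)))
       = (hcut (‖x‖ ^ 2) * (‖x‖ ^ 2) ^ 3 * kap n x + 16 * (hcut (‖x‖ ^ 2) * (‖x‖ ^ 2) ^ 3 * psi n x ^ 2))
        + 8 * (deriv hcut (‖x‖ ^ 2) * (‖x‖ ^ 2) ^ 4 * psi n x ^ 2) := fun x => by
      rw [gPP_kap, PP_psi]; ring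
    simp only [e] at k2
    have hk16 : Integrable fun x : Euc N => hcut (‖x‖ ^ 2) * (‖x‖ ^ 2) ^ 3 * kap n x
        + 16 * (hcut (‖x‖ ^ 2) * (‖x‖ ^ 2) ^ 3 * psi n x ^ 2) := hki.add (hcont.const_mul 16)
    rw [integral_add hk16 (hPi'.const_mul 8),
      integral_add hki (hcont.const_mul 16), integral_const_mul, integral_const_mul, hka, hpa, hpb] at k2
    have h1 := rad 3
    rw [show 3 + 1 = 4 from rfl] at h1
    have h2 := radpos 3
    set I := ∫ x : Euc N, hcut (‖x‖ ^ 2) * (‖x‖ ^ 2) ^ 3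
    set K := ∫ x : Euc N, deriv hcut (‖x‖ ^ 2) * (‖x‖ ^ 2) ^ 4
    set b := M (fun x => psi n x ^ 2)
    apply mul_right_cancel₀ h2.ne'
    push_cast at h1
    linear_combination k2 - 4 * b * h1
  refine ⟨M (fun x => psi n x ^ 2), hb, fun F => ?_, fun F => hM F (fun x => psi n x ^ 2) hh2, fun F => ?_⟩
  · rw [hM F _ hh1, m1, zero_mul]
  · rw [hM F _ hh3, m2]

lemma rad_grad {u : Euc N → ℝ} (hd : ∀ x, DifferentiableAt ℝ u x) (f : ℝ → ℝ) (hf : ∀ x, u x = f ‖x‖) :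
    ∃ d : ℝ → ℝ, ∀ x, gradient u x = d ‖x‖ • x := by
  have hline : ∀ x y : Euc N, ∀ t : ℝ, HasDerivAt (fun τ : ℝ => u (x + τ • y)) (inner ℝ (gradient u (x + t • y)) y) t := by
    intro x y t
    have h1 : HasDerivAt (fun τ : ℝ => x + τ • y) y t := by
      simpa using ((hasDerivAt_id t).smul_const y).const_add x
    have h2 := (hd (x + t • y)).hasGradientAt.hasFDerivAt
    have h3 := h2.comp_hasDerivAt t h1
    exact h3
  have horth : ∀ x y : Euc N, inner ℝ x y = 0 → inner ℝ (gradient u x) y = 0 := by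
    intro x y hxy
    have h1 := hline x y 0
    have h1' : HasDerivAt (fun τ : ℝ => u (x + τ • y)) (inner ℝ (gradient u x) y) (-0) := by simpa using h1
    have h2 := HasDerivAt.scomp (0:ℝ) h1' (hasDerivAt_neg (0:ℝ))
    have e : ((fun τ : ℝ => u (x + τ • y)) ∘ fun τ : ℝ => -τ) = fun τ : ℝ => u (x + τ • y) := by
      ext τ
      simp only [Function.comp]
      rw [hf, hf]
      congr 1
      rw [← sq_eq_sq₀ (norm_nonneg _) (norm_nonneg _), norm_add_sq_real, norm_add_sq_real]
      simp [inner_smul_right, hxy, norm_smul]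
    have h2' : HasDerivAt (fun τ : ℝ => u (x + τ • y)) ((-1:ℝ) • inner ℝ (gradient u x) y) 0 := by
      rw [← e]; exact h2
    have h3 := h2'.unique h1
    rw [zero_smul, add_zero, smul_eq_mul] at h3
    linarith
  refine ⟨fun r => deriv (fun τ : ℝ => f (|1 + τ| * r)) 0 / r ^ 2, fun x => ?_⟩
  have h1 := (hline x x 0).deriv
  have e : (fun τ : ℝ => u (x + τ • x)) = fun τ : ℝ => f (|1 + τ| * ‖x‖) := by
    ext τ
    rw [hf, show x + τ • x = (1 + τ) • x by rw [add_smul, one_smul], norm_smul, Real.norm_eq_abs]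
  rw [e] at h1
  simp only [zero_smul, add_zero] at h1
  simp only [h1]
  set c := inner ℝ (gradient u x) x / ‖x‖ ^ 2 with hc
  have hxy : inner ℝ x (gradient u x - c • x) = 0 := by
    rw [inner_sub_right, inner_smul_right, real_inner_self_eq_norm_sq, real_inner_comm]
    rcases eq_or_ne x 0 with rfl | hx
    · simp
    · rw [hc, div_mul_cancel₀ _ (by simpa using hx), sub_self]
  have h2 := horth x _ hxy
  have h3 : inner ℝ (gradient u x - c • x) (gradient u x - c • x) = 0 := by
    rw [inner_sub_left, h2, inner_smul_left, hxy]; simp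
  exact sub_eq_zero.1 (inner_self_eq_zero.1 h3)

lemma zeta_le (n : ℕ) (x : Euc N) : DD n x ^ 2 / (‖x‖ ^ 2) ^ 2 ≤ 1 := by
  apply div_le_one_of_le₀ _ (by positivity)
  rw [sq_le_sq, abs_of_nonneg (sq_nonneg ‖x‖)]
  exact DD_abs n x

lemma psi_bdd (n : ℕ) (x : Euc N) : |psi n x| ≤ n + 1 := by
  have h1 := zeta_le n x
  have h0 : 0 ≤ DD n x ^ 2 / (‖x‖ ^ 2) ^ 2 := by positivity
  have hn : (0:ℝ) ≤ n := by positivity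
  unfold psi
  rw [abs_le]; constructor <;> nlinarith

lemma kap_bdd (n : ℕ) (x : Euc N) : |kap n x| ≤ 16 * (n + 1) ^ 2 := by
  have h1 := zeta_le n x
  have h0 : 0 ≤ DD n x ^ 2 / (‖x‖ ^ 2) ^ 2 := by positivity
  unfold kap
  set z := DD n x ^ 2 / (‖x‖ ^ 2) ^ 2
  rw [abs_mul, abs_of_nonneg (by positivity)]
  have : |z * (1 - z)| ≤ 1 := by rw [abs_le]; constructor <;> nlinarith
  exact mul_le_of_le_one_right (by positivity) this

lemma psi_meas (n : ℕ) : Measurable (psi n : Euc N → ℝ) := by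
  have := (DD_cont (N := N) n).measurable
  unfold psi; fun_prop
lemma kap_meas (n : ℕ) : Measurable (kap n : Euc N → ℝ) := by
  have := (DD_cont (N := N) n).measurable
  unfold kap; fun_prop

def wd (n : ℕ) (δ : ℝ) (x : Euc N) : ℝ := PP n x * ((‖x‖ ^ 2) ^ 2 + δ)⁻¹
def gwd (n : ℕ) (δ : ℝ) (x : Euc N) : Euc N :=
  ((‖x‖ ^ 2) ^ 2 + δ)⁻¹ • gPP n x - (PP n x * 4 * ‖x‖ ^ 2 * (((‖x‖ ^ 2) ^ 2 + δ) ^ 2)⁻¹) • x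
def a1 (δ : ℝ) (r : ℝ) : ℝ := (r ^ 2) ^ 2 / ((r ^ 2) ^ 2 + δ)
def a2 (δ : ℝ) (r : ℝ) : ℝ := 4 * (r ^ 2) ^ 2 * δ / ((r ^ 2) ^ 2 + δ) ^ 2

lemma a1_bd {δ : ℝ} (hδ : 0 < δ) (r : ℝ) : 0 ≤ a1 δ r ∧ a1 δ r ≤ 1 := by
  unfold a1
  refine ⟨by positivity, (div_le_one₀ (by positivity)).2 (by linarith)⟩
lemma a2_bd {δ : ℝ} (hδ : 0 < δ) (r : ℝ) : 0 ≤ a2 δ r ∧ a2 δ r ≤ 1 := by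
  unfold a2
  refine ⟨by positivity, (div_le_one₀ (by positivity)).2 (by nlinarith [sq_nonneg ((r ^ 2) ^ 2 - δ)])⟩
lemma a1_cont {δ : ℝ} (hδ : 0 < δ) : Continuous (a1 δ) := by
  unfold a1
  exact Continuous.div (by fun_prop) (by fun_prop) fun r => by positivity
lemma a2_cont {δ : ℝ} (hδ : 0 < δ) : Continuous (a2 δ) := by
  unfold a2
  exact Continuous.div (by fun_prop) (by fun_prop) fun r => by positivity

lemma a1_lim {r : ℝ} (hr : r ≠ 0) : Tendsto (fun k : ℕ => a1 (1 / ((k:ℝ) + 1)) r) atTop (𝓝 1) := by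
  have h := tendsto_one_div_add_atTop_nhds_zero_nat (𝕜 := ℝ)
  have h2 : Tendsto (fun k : ℕ => (r ^ 2) ^ 2 / ((r ^ 2) ^ 2 + 1 / ((k:ℝ) + 1))) atTop (𝓝 ((r ^ 2) ^ 2 / ((r ^ 2) ^ 2 + 0))) :=
    Tendsto.div tendsto_const_nhds (h.const_add _) (by positivity)
  rw [add_zero, div_self (by positivity)] at h2
  exact h2
lemma a2_lim {r : ℝ} (hr : r ≠ 0) : Tendsto (fun k : ℕ => a2 (1 / ((k:ℝ) + 1)) r) atTop (𝓝 0) := by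
  have h := tendsto_one_div_add_atTop_nhds_zero_nat (𝕜 := ℝ)
  have h2 : Tendsto (fun k : ℕ => 4 * (r ^ 2) ^ 2 * (1 / ((k:ℝ) + 1)) / ((r ^ 2) ^ 2 + 1 / ((k:ℝ) + 1)) ^ 2) atTop
      (𝓝 (4 * (r ^ 2) ^ 2 * 0 / ((r ^ 2) ^ 2 + 0) ^ 2)) :=
    Tendsto.div (h.const_mul _) ((h.const_add _).pow 2) (by positivity)
  rw [mul_zero, zero_div] at h2
  exact h2

lemma hg_wd (n : ℕ) {δ : ℝ} (hδ : 0 < δ) (x : Euc N) : HasGradientAt (wd n δ) (gwd n δ x) x := by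
  have hq : ((‖x‖ ^ 2) ^ 2 + δ) ≠ 0 := by positivity
  have hφ : HasDerivAt (fun s : ℝ => (s ^ 2 + δ)⁻¹) (-(2 * ‖x‖ ^ 2) / ((‖x‖ ^ 2) ^ 2 + δ) ^ 2) (‖x‖ ^ 2) := by
    have := ((hasDerivAt_pow 2 (‖x‖ ^ 2)).add_const δ).fun_inv hq
    simpa using this
  have h1 := hg_comp (f := fun y : Euc N => ‖y‖ ^ 2) hφ (hg_nsq x)
  have h2 := hg_mul (hg_PP n x) h1
  have e : gwd n δ x = PP n x • (-(2 * ‖x‖ ^ 2) / ((‖x‖ ^ 2) ^ 2 + δ) ^ 2) • (2:ℝ) • x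
      + ((‖x‖ ^ 2) ^ 2 + δ)⁻¹ • gPP n x := by
    ext j
    simp [gwd]; ring
  rw [e]
  exact h2

lemma wd_eq (n : ℕ) (δ : ℝ) (x : Euc N) : wd n δ x = a1 δ ‖x‖ * psi n x := by
  rw [wd, PP_psi, a1]; ring

lemma gwd_inner (n : ℕ) {δ : ℝ} (hδ : 0 < δ) (x : Euc N) : inner ℝ x (gwd n δ x) = a2 δ ‖x‖ * psi n x := by
  have hq : ((‖x‖ ^ 2) ^ 2 + δ) ≠ 0 := by positivity
  simp only [gwd, inner_sub_right, inner_smul_right, gPP_inner', real_inner_self_eq_norm_sq, PP_psi, a2]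
  field_simp
  ring

lemma gwd_sq (n : ℕ) {δ : ℝ} (hδ : 0 < δ) (x : Euc N) : ‖gwd n δ x‖ ^ 2 =
    (a1 δ ‖x‖ ^ 2 * kap n x + a2 δ ‖x‖ ^ 2 * psi n x ^ 2) / ‖x‖ ^ 2 := by
  have hq : ((‖x‖ ^ 2) ^ 2 + δ) ≠ 0 := by positivity
  rcases eq_or_ne x 0 with rfl | hx
  · simp [gwd, gPP, DD]
  have hr : ‖x‖ ≠ 0 := norm_ne_zero_iff.2 hx
  have hs : ‖gwd n δ x‖ ^ 2 = (((‖x‖ ^ 2) ^ 2 + δ)⁻¹) ^ 2 * ‖gPP n x‖ ^ 2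
     - 2 * ((‖x‖ ^ 2) ^ 2 + δ)⁻¹ * (PP n x * 4 * ‖x‖ ^ 2 * (((‖x‖ ^ 2) ^ 2 + δ) ^ 2)⁻¹) * (4 * PP n x)
     + (PP n x * 4 * ‖x‖ ^ 2 * (((‖x‖ ^ 2) ^ 2 + δ) ^ 2)⁻¹) ^ 2 * ‖x‖ ^ 2 := by
    rw [gwd, norm_sub_sq_real, norm_smul, norm_smul, inner_smul_left, inner_smul_right, gPP_inner,
      mul_pow, mul_pow, Real.norm_eq_abs, Real.norm_eq_abs, sq_abs, sq_abs, conj_trivial]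
    ring
  rw [hs, gPP_kap, PP_psi, a1, a2]
  set r := ‖x‖
  field_simp
  ring

lemma lim_int {c : ℕ → Euc N → ℝ} {c0 : ℝ} {g : Euc N → ℝ} (hg : Integrable g)
    (hc : ∀ k, Continuous (c k)) (hb : ∀ k x, |c k x| ≤ 1)
    (hN : 0 < N) (hl : ∀ x, x ≠ 0 → Tendsto (fun k => c k x) atTop (𝓝 c0)) :
    Tendsto (fun k => ∫ x, c k x * g x) atTop (𝓝 (c0 * ∫ x, g x)) := by
  have : Nonempty (Fin N) := ⟨⟨0, hN⟩⟩
  rw [← integral_const_mul]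
  refine tendsto_integral_of_dominated_convergence (fun x => |g x|)
    (fun k => (hc k).aestronglyMeasurable.mul hg.aestronglyMeasurable) hg.abs ?_ ?_
  · intro k; refine ae_of_all _ fun x => ?_
    rw [Real.norm_eq_abs, abs_mul]
    exact mul_le_of_le_one_left (abs_nonneg _) (hb k x)
  · have : ∀ᵐ x : Euc N, x ≠ 0 := by
      rw [ae_iff]; simp
    filter_upwards [this] with x hx
    exact (hl x hx).mul_const _

lemma int_bm {c : Euc N → ℝ} {g : Euc N → ℝ} {C : ℝ} (hg : Integrable g)
    (hc : Measurable c) (hb : ∀ x, |c x| ≤ C) : Integrable fun x => c x * g x :=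
  hg.bdd_mul (c := C) hc.aestronglyMeasurable (ae_of_all _ fun x => by simpa using hb x)

lemma sq_mul_abs_le {a b : ℝ} (ha : 0 ≤ a ∧ a ≤ 1) (hb : 0 ≤ b ∧ b ≤ 1) : |a * b| ≤ 1 := by
  rw [abs_of_nonneg (mul_nonneg ha.1 hb.1)]
  exact mul_le_one₀ ha.2 hb.1 hb.2

lemma v_identity {n : ℕ} {u : Euc N → ℝ} (hd : ∀ x, DifferentiableAt ℝ u x) {d : ℝ → ℝ}
    (hdg : ∀ x, gradient u x = d ‖x‖ • x) {δ : ℝ} (hδ : 0 < δ) (ε : ℝ) (x : Euc N) :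
    HasGradientAt (fun x => u x * (1 + ε * wd n δ x))
      ((1 + ε * wd n δ x) • gradient u x + (ε * u x) • gwd n δ x) x ∧
    ‖(1 + ε * wd n δ x) • gradient u x + (ε * u x) • gwd n δ x‖ ^ 2 + (u x * (1 + ε * wd n δ x)) ^ 2
     = (‖gradient u x‖ ^ 2 + u x ^ 2)
      + ε * (2 * (a1 δ ‖x‖ * ‖gradient u x‖ ^ 2 + a1 δ ‖x‖ * u x ^ 2
          + a2 δ ‖x‖ * (inner ℝ (gradient u x) x * u x / ‖x‖ ^ 2)) * psi n x)
      + ε ^ 2 * (((a1 δ ‖x‖ * a1 δ ‖x‖) * ‖gradient u x‖ ^ 2 + (a1 δ ‖x‖ * a1 δ ‖x‖) * u x ^ 2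
          + 2 * ((a1 δ ‖x‖ * a2 δ ‖x‖) * (inner ℝ (gradient u x) x * u x / ‖x‖ ^ 2))
          + (a2 δ ‖x‖ * a2 δ ‖x‖) * (u x ^ 2 / ‖x‖ ^ 2)) * psi n x ^ 2
        + ((a1 δ ‖x‖ * a1 δ ‖x‖) * (u x ^ 2 / ‖x‖ ^ 2)) * kap n x) := by
  constructor
  · have h2 : HasGradientAt (fun y => 1 + ε * wd n δ y) (ε • gwd n δ x) x := by
      have h := hg_smul ε (hg_wd n hδ x)
      rw [hasGradientAt_iff_hasFDerivAt] at h ⊢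
      exact h.const_add 1
    have h3 := hg_mul (hd x).hasGradientAt h2
    rw [smul_smul, add_comm, mul_comm (u x) ε] at h3
    exact h3
  · have hx : inner ℝ (gradient u x) (gwd n δ x) * u x =
        a2 δ ‖x‖ * psi n x * (inner ℝ (gradient u x) x * u x / ‖x‖ ^ 2) := by
      rw [hdg, inner_smul_left, inner_smul_left, gwd_inner n hδ, real_inner_self_eq_norm_sq, conj_trivial]
      rcases eq_or_ne x 0 with rfl | hx
      · simp [a2]
      · have hr : ‖x‖ ≠ 0 := norm_ne_zero_iff.2 hx
        field_simp
    rw [norm_add_sq_real, norm_smul, norm_smul, inner_smul_left, inner_smul_right,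
      mul_pow, mul_pow, Real.norm_eq_abs, Real.norm_eq_abs, sq_abs, sq_abs, conj_trivial, gwd_sq n hδ, wd_eq]
    linear_combination (2 * ε * (1 + ε * (a1 δ ‖x‖ * psi n x))) * hx

lemma test_fun {n : ℕ} (hn : 1 ≤ n) (hN : N = 2 * n) {u : Euc N → ℝ} {f : ℝ → ℝ} (hu : MemH1 u)
    (hf : ∀ x, u x = f ‖x‖) (h3 : Integrable fun x => u x ^ 2 / ‖x‖ ^ 2) {ρ : Euc N → ℝ} {F : ℝ → ℝ}
    (hρ : ∀ x, ρ x = F ‖x‖) (hρi : Integrable ρ) {p : ℝ}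
    (hρA : ∫ x, ρ x = ∫ x, (‖gradient u x‖ ^ 2 + u x ^ 2)) (hpos : 0 < ∫ x, ρ x)
    (hlt : 4 * (N + 2) * ∫ x, u x ^ 2 / ‖x‖ ^ 2 < (p - 2) * ∫ x, ρ x) :
    ∃ δ > 0, ∃ a I : ℝ, 0 < I ∧ a < (p - 1) * I ∧
      (∀ ε : ℝ, MemH1 (fun x => u x * (1 + ε * wd n δ x)) ∧
        ∫ x, (‖gradient (fun x => u x * (1 + ε * wd n δ x)) x‖ ^ 2 + (u x * (1 + ε * wd n δ x)) ^ 2)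
          = (∫ x, ρ x) + ε ^ 2 * a) ∧
      ∫ x, ρ x * wd n δ x = 0 ∧ ∫ x, ρ x * wd n δ x ^ 2 = I := by
  obtain ⟨hc, hd, h1, h2⟩ := hu
  obtain ⟨d, hdg⟩ := rad_grad hd f hf
  have hN0 : 0 < N := by omega
  obtain ⟨b, hb, sf1, sf2, sf3⟩ := sphere_facts hn hN
  have hmg := meas_gradient u
  have h4 : Integrable fun x => inner ℝ (gradient u x) x * u x / ‖x‖ ^ 2 := by
    refine (h1.add h3).mono' (by
      have := hc.measurable
      apply Measurable.aestronglyMeasurable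
      fun_prop) (ae_of_all _ fun x => ?_)
    rcases eq_or_ne x 0 with rfl | hx
    · simp
    have hr : 0 < ‖x‖ := norm_pos_iff.2 hx
    have hi := abs_real_inner_le_norm (gradient u x) x
    rw [Real.norm_eq_abs, abs_div, abs_mul, abs_of_pos (show 0 < ‖x‖ ^ 2 by positivity)]
    have e1 : |inner ℝ (gradient u x) x| * |u x| / ‖x‖ ^ 2 ≤ ‖gradient u x‖ * (|u x| / ‖x‖) := by
      rw [div_le_iff₀ (by positivity)]
      calc _ ≤ ‖gradient u x‖ * ‖x‖ * |u x| := by gcongr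
        _ = _ := by field_simp
    have e2 : u x ^ 2 / ‖x‖ ^ 2 = (|u x| / ‖x‖) ^ 2 := by rw [div_pow, sq_abs]
    simp only [Pi.add_apply, e2]
    have := norm_nonneg (gradient u x)
    have h5 : 0 ≤ |u x| / ‖x‖ := by positivity
    nlinarith [sq_nonneg (‖gradient u x‖ - |u x| / ‖x‖)]
  -- radial profiles
  let k1 : ℝ → ℝ := fun r => (d r) ^ 2 * r ^ 2
  let k4 : ℝ → ℝ := fun r => d r * r ^ 2 * f r / r ^ 2
  have r1 : ∀ x, ‖gradient u x‖ ^ 2 = k1 ‖x‖ := fun x => by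
    rw [hdg, norm_smul, mul_pow, Real.norm_eq_abs, sq_abs]
  have r4 : ∀ x, inner ℝ (gradient u x) x * u x / ‖x‖ ^ 2 = k4 ‖x‖ := fun x => by
    rw [hdg, inner_smul_left, real_inner_self_eq_norm_sq, hf, conj_trivial]
  have hpm := psi_meas (N := N) n
  have hkm := kap_meas (N := N) n
  have hpb := psi_bdd (N := N) n
  have hkb := kap_bdd (N := N) n
  have hp2b : ∀ x : Euc N, |psi n x ^ 2| ≤ ((n:ℝ) + 1) ^ 2 := fun x => by
    rw [abs_pow]; exact pow_le_pow_left₀ (abs_nonneg _) (hpb x) 2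
  -- integrability with coefficients
  have ic1 : ∀ δ : ℝ, 0 < δ → ∀ g : Euc N → ℝ, Integrable g → Integrable fun x => a1 δ ‖x‖ * g x :=
    fun δ hδ g hg => int_bm (C := 1) hg ((a1_cont hδ).comp continuous_norm).measurable fun x => by
      rw [abs_of_nonneg (a1_bd hδ _).1]; exact (a1_bd hδ _).2
  have ic2 : ∀ δ : ℝ, 0 < δ → ∀ g : Euc N → ℝ, Integrable g → Integrable fun x => a2 δ ‖x‖ * g x :=
    fun δ hδ g hg => int_bm (C := 1) hg ((a2_cont hδ).comp continuous_norm).measurable fun x => by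
      rw [abs_of_nonneg (a2_bd hδ _).1]; exact (a2_bd hδ _).2
  have ic11 : ∀ δ : ℝ, 0 < δ → ∀ g : Euc N → ℝ, Integrable g → Integrable fun x => a1 δ ‖x‖ * a1 δ ‖x‖ * g x :=
    fun δ hδ g hg => by simpa only [mul_assoc] using ic1 δ hδ _ (ic1 δ hδ g hg)
  have ic12 : ∀ δ : ℝ, 0 < δ → ∀ g : Euc N → ℝ, Integrable g → Integrable fun x => a1 δ ‖x‖ * a2 δ ‖x‖ * g x :=
    fun δ hδ g hg => by simpa only [mul_assoc] using ic1 δ hδ _ (ic2 δ hδ g hg)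
  have ic22 : ∀ δ : ℝ, 0 < δ → ∀ g : Euc N → ℝ, Integrable g → Integrable fun x => a2 δ ‖x‖ * a2 δ ‖x‖ * g x :=
    fun δ hδ g hg => by simpa only [mul_assoc] using ic2 δ hδ _ (ic2 δ hδ g hg)
  -- limits
  let dl : ℕ → ℝ := fun k => 1 / ((k:ℝ) + 1)
  have hdl : ∀ k, 0 < dl k := fun k => by simp only [dl]; positivity
  have hr0 : ∀ x : Euc N, x ≠ 0 → ‖x‖ ≠ 0 := fun x hx => norm_ne_zero_iff.2 hx
  have lim11 : ∀ g : Euc N → ℝ, Integrable g →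
      Tendsto (fun k => ∫ x, a1 (dl k) ‖x‖ * a1 (dl k) ‖x‖ * g x) atTop (𝓝 (∫ x, g x)) := fun g hg => by
    have := lim_int (c := fun k x => a1 (dl k) ‖x‖ * a1 (dl k) ‖x‖) (c0 := 1 * 1) hg
      (fun k => ((a1_cont (hdl k)).comp continuous_norm).mul ((a1_cont (hdl k)).comp continuous_norm))
      (fun k x => sq_mul_abs_le (a1_bd (hdl k) _) (a1_bd (hdl k) _)) hN0
      (fun x hx => (a1_lim (hr0 x hx)).mul (a1_lim (hr0 x hx)))
    simpa using this
  have lim12 : ∀ g : Euc N → ℝ, Integrable g →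
      Tendsto (fun k => ∫ x, a1 (dl k) ‖x‖ * a2 (dl k) ‖x‖ * g x) atTop (𝓝 0) := fun g hg => by
    have := lim_int (c := fun k x => a1 (dl k) ‖x‖ * a2 (dl k) ‖x‖) (c0 := 1 * 0) hg
      (fun k => ((a1_cont (hdl k)).comp continuous_norm).mul ((a2_cont (hdl k)).comp continuous_norm))
      (fun k x => sq_mul_abs_le (a1_bd (hdl k) _) (a2_bd (hdl k) _)) hN0
      (fun x hx => (a1_lim (hr0 x hx)).mul (a2_lim (hr0 x hx)))
    simpa using this
  have lim22 : ∀ g : Euc N → ℝ, Integrable g →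
      Tendsto (fun k => ∫ x, a2 (dl k) ‖x‖ * a2 (dl k) ‖x‖ * g x) atTop (𝓝 0) := fun g hg => by
    have := lim_int (c := fun k x => a2 (dl k) ‖x‖ * a2 (dl k) ‖x‖) (c0 := 0 * 0) hg
      (fun k => ((a2_cont (hdl k)).comp continuous_norm).mul ((a2_cont (hdl k)).comp continuous_norm))
      (fun k x => sq_mul_abs_le (a2_bd (hdl k) _) (a2_bd (hdl k) _)) hN0
      (fun x hx => (a2_lim (hr0 x hx)).mul (a2_lim (hr0 x hx)))
    simpa using this
  let AA : ℝ → ℝ := fun δ => b * ((∫ x, a1 δ ‖x‖ * a1 δ ‖x‖ * ‖gradient u x‖ ^ 2)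
      + (∫ x, a1 δ ‖x‖ * a1 δ ‖x‖ * u x ^ 2)
      + 2 * (∫ x, a1 δ ‖x‖ * a2 δ ‖x‖ * (inner ℝ (gradient u x) x * u x / ‖x‖ ^ 2))
      + ∫ x, a2 δ ‖x‖ * a2 δ ‖x‖ * (u x ^ 2 / ‖x‖ ^ 2))
      + 4 * (N + 2) * b * ∫ x, a1 δ ‖x‖ * a1 δ ‖x‖ * (u x ^ 2 / ‖x‖ ^ 2)
  let II : ℝ → ℝ := fun δ => b * ∫ x, a1 δ ‖x‖ * a1 δ ‖x‖ * ρ x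
  have hA : Tendsto (fun k => AA (dl k)) atTop (𝓝 (b * ((∫ x, ‖gradient u x‖ ^ 2) + (∫ x, u x ^ 2) + 2 * 0 + 0)
      + 4 * (N + 2) * b * ∫ x, u x ^ 2 / ‖x‖ ^ 2)) :=
    (((((lim11 _ h1).add (lim11 _ h2)).add ((lim12 _ h4).const_mul 2)).add (lim22 _ h3)).const_mul b).add
      ((lim11 _ h3).const_mul _)
  have hI : Tendsto (fun k => II (dl k)) atTop (𝓝 (b * ∫ x, ρ x)) := (lim11 _ hρi).const_mul b
  have hA0 : ∫ x, ρ x = (∫ x, ‖gradient u x‖ ^ 2) + (∫ x, u x ^ 2) := by rw [hρA, integral_add h1 h2]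
  have hfin : (b * ((∫ x, ‖gradient u x‖ ^ 2) + (∫ x, u x ^ 2) + 2 * 0 + 0)
      + 4 * (N + 2) * b * ∫ x, u x ^ 2 / ‖x‖ ^ 2) < (p - 1) * (b * ∫ x, ρ x) := by
    rw [← hA0]
    have := mul_lt_mul_of_pos_left hlt hb
    linarith
  obtain ⟨k, hk1, hk2⟩ := ((hA.eventually_lt (hI.const_mul (p - 1)) hfin).and
    (hI.eventually_const_lt (mul_pos hb hpos))).exists
  have hδ := hdl k
  generalize dl k = δ at hk1 hk2 hδ
  refine ⟨δ, hδ, AA δ, II δ, hk2, hk1, fun ε => ?_, ?_, ?_⟩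
  · have hvi := fun x => v_identity (n := n) hd hdg hδ ε x
    have hgr : ∀ x, gradient (fun x => u x * (1 + ε * wd n δ x)) x =
        (1 + ε * wd n δ x) • gradient u x + (ε * u x) • gwd n δ x := fun x => (hvi x).1.gradient
    have hvd : ∀ x, DifferentiableAt ℝ (fun x => u x * (1 + ε * wd n δ x)) x := fun x =>
      (hvi x).1.differentiableAt
    have hvc : Continuous (fun x => u x * (1 + ε * wd n δ x)) :=
      continuous_iff_continuousAt.2 fun x => (hvd x).continuousAt
    -- integrable pieces
    have j0 : Integrable fun x => ‖gradient u x‖ ^ 2 + u x ^ 2 := h1.add h2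
    have jG : Integrable fun x => (a1 δ ‖x‖ * ‖gradient u x‖ ^ 2 + a1 δ ‖x‖ * u x ^ 2
          + a2 δ ‖x‖ * (inner ℝ (gradient u x) x * u x / ‖x‖ ^ 2)) :=
      ((ic1 δ hδ _ h1).add (ic1 δ hδ _ h2)).add (ic2 δ hδ _ h4)
    have jGp : Integrable fun x => 2 * (a1 δ ‖x‖ * ‖gradient u x‖ ^ 2 + a1 δ ‖x‖ * u x ^ 2
          + a2 δ ‖x‖ * (inner ℝ (gradient u x) x * u x / ‖x‖ ^ 2)) * psi n x := by
      have := int_bm (jG.const_mul 2) hpm hpb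
      simpa only [mul_comm] using this
    have jR1a : Integrable fun x => (a1 δ ‖x‖ * a1 δ ‖x‖) * ‖gradient u x‖ ^ 2 + (a1 δ ‖x‖ * a1 δ ‖x‖) * u x ^ 2 :=
      (ic11 δ hδ _ h1).add (ic11 δ hδ _ h2)
    have jR1b : Integrable fun x => (a1 δ ‖x‖ * a1 δ ‖x‖) * ‖gradient u x‖ ^ 2 + (a1 δ ‖x‖ * a1 δ ‖x‖) * u x ^ 2
          + 2 * ((a1 δ ‖x‖ * a2 δ ‖x‖) * (inner ℝ (gradient u x) x * u x / ‖x‖ ^ 2)) :=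
      jR1a.add ((ic12 δ hδ _ h4).const_mul 2)
    have jR1 : Integrable fun x => (a1 δ ‖x‖ * a1 δ ‖x‖) * ‖gradient u x‖ ^ 2 + (a1 δ ‖x‖ * a1 δ ‖x‖) * u x ^ 2
          + 2 * ((a1 δ ‖x‖ * a2 δ ‖x‖) * (inner ℝ (gradient u x) x * u x / ‖x‖ ^ 2))
          + (a2 δ ‖x‖ * a2 δ ‖x‖) * (u x ^ 2 / ‖x‖ ^ 2) := jR1b.add (ic22 δ hδ _ h3)
    have jR1p : Integrable fun x => ((a1 δ ‖x‖ * a1 δ ‖x‖) * ‖gradient u x‖ ^ 2 + (a1 δ ‖x‖ * a1 δ ‖x‖) * u x ^ 2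
          + 2 * ((a1 δ ‖x‖ * a2 δ ‖x‖) * (inner ℝ (gradient u x) x * u x / ‖x‖ ^ 2))
          + (a2 δ ‖x‖ * a2 δ ‖x‖) * (u x ^ 2 / ‖x‖ ^ 2)) * psi n x ^ 2 :=
      (int_bm jR1 (hpm.pow_const 2) hp2b).congr (ae_of_all _ fun x => mul_comm _ _)
    have jR2p : Integrable fun x => ((a1 δ ‖x‖ * a1 δ ‖x‖) * (u x ^ 2 / ‖x‖ ^ 2)) * kap n x :=
      (int_bm (ic11 δ hδ _ h3) hkm hkb).congr (ae_of_all _ fun x => mul_comm _ _)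
    have jR : Integrable fun x => ((a1 δ ‖x‖ * a1 δ ‖x‖) * ‖gradient u x‖ ^ 2 + (a1 δ ‖x‖ * a1 δ ‖x‖) * u x ^ 2
          + 2 * ((a1 δ ‖x‖ * a2 δ ‖x‖) * (inner ℝ (gradient u x) x * u x / ‖x‖ ^ 2))
          + (a2 δ ‖x‖ * a2 δ ‖x‖) * (u x ^ 2 / ‖x‖ ^ 2)) * psi n x ^ 2
        + ((a1 δ ‖x‖ * a1 δ ‖x‖) * (u x ^ 2 / ‖x‖ ^ 2)) * kap n x := jR1p.add jR2p
    have jj : Integrable fun x => (‖gradient u x‖ ^ 2 + u x ^ 2)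
      + ε * (2 * (a1 δ ‖x‖ * ‖gradient u x‖ ^ 2 + a1 δ ‖x‖ * u x ^ 2
          + a2 δ ‖x‖ * (inner ℝ (gradient u x) x * u x / ‖x‖ ^ 2)) * psi n x) := j0.add (jGp.const_mul ε)
    have hint : Integrable fun x => ‖gradient (fun x => u x * (1 + ε * wd n δ x)) x‖ ^ 2
        + (u x * (1 + ε * wd n δ x)) ^ 2 := by
      simp only [hgr, fun x => (hvi x).2]
      exact jj.add (jR.const_mul (ε ^ 2))
    have hmv := meas_gradient (fun x => u x * (1 + ε * wd n δ x))
    refine ⟨⟨hvc, hvd, ?_, ?_⟩, ?_⟩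
    · refine hint.mono' (by fun_prop) (ae_of_all _ fun x => ?_)
      rw [Real.norm_of_nonneg (by positivity)]
      nlinarith [sq_nonneg (u x * (1 + ε * wd n δ x))]
    · refine hint.mono' (hvc.pow 2).aestronglyMeasurable (ae_of_all _ fun x => ?_)
      rw [Real.norm_of_nonneg (by positivity)]
      nlinarith [sq_nonneg (‖gradient (fun x => u x * (1 + ε * wd n δ x)) x‖)]
    · have z1 : ∫ x, 2 * (a1 δ ‖x‖ * ‖gradient u x‖ ^ 2 + a1 δ ‖x‖ * u x ^ 2
          + a2 δ ‖x‖ * (inner ℝ (gradient u x) x * u x / ‖x‖ ^ 2)) * psi n x = 0 := by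
        simp only [r1, r4]
        simp only [hf]
        exact sf1 fun r => 2 * (a1 δ r * k1 r + a1 δ r * f r ^ 2 + a2 δ r * k4 r)
      have z2 : ∫ x, ((a1 δ ‖x‖ * a1 δ ‖x‖) * ‖gradient u x‖ ^ 2 + (a1 δ ‖x‖ * a1 δ ‖x‖) * u x ^ 2
          + 2 * ((a1 δ ‖x‖ * a2 δ ‖x‖) * (inner ℝ (gradient u x) x * u x / ‖x‖ ^ 2))
          + (a2 δ ‖x‖ * a2 δ ‖x‖) * (u x ^ 2 / ‖x‖ ^ 2)) * psi n x ^ 2 =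
          b * ∫ x, ((a1 δ ‖x‖ * a1 δ ‖x‖) * ‖gradient u x‖ ^ 2 + (a1 δ ‖x‖ * a1 δ ‖x‖) * u x ^ 2
          + 2 * ((a1 δ ‖x‖ * a2 δ ‖x‖) * (inner ℝ (gradient u x) x * u x / ‖x‖ ^ 2))
          + (a2 δ ‖x‖ * a2 δ ‖x‖) * (u x ^ 2 / ‖x‖ ^ 2)) := by
        simp only [r1, r4]
        simp only [hf]
        exact sf2 fun r => (a1 δ r * a1 δ r) * k1 r + (a1 δ r * a1 δ r) * f r ^ 2
          + 2 * ((a1 δ r * a2 δ r) * k4 r) + (a2 δ r * a2 δ r) * (f r ^ 2 / r ^ 2)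
      have z3 : ∫ x, ((a1 δ ‖x‖ * a1 δ ‖x‖) * (u x ^ 2 / ‖x‖ ^ 2)) * kap n x =
          4 * (N + 2) * b * ∫ x, (a1 δ ‖x‖ * a1 δ ‖x‖) * (u x ^ 2 / ‖x‖ ^ 2) := by
        simp only [hf]
        exact sf3 fun r => (a1 δ r * a1 δ r) * (f r ^ 2 / r ^ 2)
      simp only [hgr, fun x => (hvi x).2]
      rw [integral_add jj (jR.const_mul _), integral_add j0 (jGp.const_mul _), integral_const_mul,
        integral_const_mul, z1, integral_add jR1p jR2p, z2, z3, integral_add jR1b (ic22 δ hδ _ h3),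
        integral_add jR1a ((ic12 δ hδ _ h4).const_mul 2), integral_const_mul,
        integral_add (ic11 δ hδ _ h1) (ic11 δ hδ _ h2), ← hρA, mul_zero, add_zero]
  · have := sf1 fun r => F r * a1 δ r
    simp only [wd_eq, hρ, ← mul_assoc]
    exact this
  · have := sf2 fun r => a1 δ r * a1 δ r * F r
    simp only [II, hρ]
    rw [← this]
    congr 1; ext x; rw [wd_eq]; ring

lemma deriv_neg_lt {h : ℝ → ℝ} {c : ℝ} (hd : HasDerivAt h c 0) (hc : c < 0) :
    ∃ s0 > 0, (∀ s, 0 < s → s < s0 → h s < h 0) ∧ ∀ s, s < 0 → - s0 < s → h 0 < h s := by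
  have h1 := hasDerivAt_iff_tendsto_slope.1 hd
  have h2 := h1.eventually_lt_const hc
  rw [eventually_nhdsWithin_iff, Metric.eventually_nhds_iff] at h2
  obtain ⟨s0, hs0, h3⟩ := h2
  refine ⟨s0, hs0, fun s hs hs' => ?_, fun s hs hs' => ?_⟩
  · have := h3 (y := s) (by simpa [abs_of_pos hs] using hs') hs.ne'
    rw [slope_def_field, sub_zero, div_neg_iff] at this
    rcases this with h | h <;> linarith [h.1, h.2]
  · have := h3 (y := s) (by simp [abs_of_neg hs]; linarith) hs.ne
    rw [slope_def_field, sub_zero, div_neg_iff] at this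
    rcases this with h | h <;> linarith [h.1, h.2]

lemma taylor_lb {p θ : ℝ} (hp : 2 < p) (hθ : θ < 1) :
    ∃ y0 > 0, y0 < 1 ∧ ∀ y : ℝ, |y| ≤ y0 → 1 + p * y + θ * (p * (p - 1) / 2) * y ^ 2 ≤ (1 + y) ^ p := by
  have hg : HasDerivAt (fun y : ℝ => 1 + θ * (p - 1) * y - (1 + y) ^ (p - 1)) (θ * (p - 1) - (p - 1)) 0 := by
    have h1 : HasDerivAt (fun y : ℝ => (1 + y) ^ (p - 1)) (p - 1) 0 := by
      have := ((hasDerivAt_id (0:ℝ)).const_add 1).rpow_const (p := p - 1) (by simp)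
      simpa using this
    have h2 : HasDerivAt (fun y : ℝ => 1 + θ * (p - 1) * y) (θ * (p - 1)) 0 := by
      simpa using ((hasDerivAt_id (0:ℝ)).const_mul (θ * (p - 1))).const_add 1
    exact h2.sub h1
  obtain ⟨s0, hs0, hA, hB⟩ := deriv_neg_lt hg (by nlinarith)
  simp only [mul_zero, add_zero, one_rpow, sub_self] at hA hB
  let y0 := min (s0 / 2) (1 / 2)
  have hy0 : 0 < y0 := by positivity
  have hy1 : y0 ≤ s0 / 2 := min_le_left _ _
  have hy2 : y0 ≤ 1 / 2 := min_le_right _ _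
  let h : ℝ → ℝ := fun y => (1 + y) ^ p - (1 + p * y + θ * (p * (p - 1) / 2) * y ^ 2)
  have hder : ∀ y : ℝ, -1 < y → HasDerivAt h (p * ((1 + y) ^ (p - 1) - (1 + θ * (p - 1) * y))) y := by
    intro y hy
    have h1 : HasDerivAt (fun y : ℝ => (1 + y) ^ p) (p * (1 + y) ^ (p - 1)) y := by
      have := ((hasDerivAt_id y).const_add 1).rpow_const (p := p) (Or.inl (by simp; linarith))
      simpa using this
    have h2 : HasDerivAt (fun y : ℝ => 1 + p * y + θ * (p * (p - 1) / 2) * y ^ 2)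
        (p + θ * (p * (p - 1) / 2) * (2 * y)) y := by
      have ha := ((hasDerivAt_id y).const_mul p).const_add 1
      have hb := (hasDerivAt_pow 2 y).const_mul (θ * (p * (p - 1) / 2))
      simpa using ha.fun_add hb
    have h3 := h1.sub h2
    have e : p * ((1 + y) ^ (p - 1) - (1 + θ * (p - 1) * y)) =
      p * (1 + y) ^ (p - 1) - (p + θ * (p * (p - 1) / 2) * (2 * y)) := by ring
    rw [e]; exact h3
  have h00 : h 0 = 0 := by simp [h]
  refine ⟨y0, hy0, by linarith, fun y hy => ?_⟩
  rw [abs_le] at hy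
  suffices 0 ≤ h y by simp only [h] at this; linarith
  rcases le_total 0 y with hy0 | hy0
  · have hm : MonotoneOn h (Icc 0 y) := by
      refine monotoneOn_of_deriv_nonneg (convex_Icc _ _) ?_ ?_ ?_
      · intro z hz; exact (hder z (by linarith [hz.1])).continuousAt.continuousWithinAt
      · intro z hz; rw [interior_Icc] at hz
        exact (hder z (by linarith [hz.1])).differentiableAt.differentiableWithinAt
      · intro z hz; rw [interior_Icc] at hz
        rw [(hder z (by linarith [hz.1])).deriv]
        have := hA z hz.1 (by linarith [hz.2])
        exact mul_nonneg (by linarith) (by linarith)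
    have := hm (left_mem_Icc.2 hy0) (right_mem_Icc.2 hy0) hy0
    rwa [h00] at this
  · have hm : AntitoneOn h (Icc y 0) := by
      refine antitoneOn_of_deriv_nonpos (convex_Icc _ _) ?_ ?_ ?_
      · intro z hz; exact (hder z (by linarith [hz.1])).continuousAt.continuousWithinAt
      · intro z hz; rw [interior_Icc] at hz
        exact (hder z (by linarith [hz.1])).differentiableAt.differentiableWithinAt
      · intro z hz; rw [interior_Icc] at hz
        rw [(hder z (by linarith [hz.1])).deriv]
        have := hB z hz.2 (by linarith [hz.1])
        exact mul_nonpos_of_nonneg_of_nonpos (by linarith) (by linarith)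
    have := hm (left_mem_Icc.2 hy0) (right_mem_Icc.2 hy0) hy0
    rwa [h00] at this

lemma small_eps {p a c A0 : ℝ} (h : p / 2 * (a / A0) < c) :
    ∃ s0 > 0, ∀ s, 0 < s → s < s0 → (1 + s * (a / A0)) ^ (p / 2) < 1 + s * c := by
  have hd : HasDerivAt (fun s : ℝ => (1 + s * (a / A0)) ^ (p / 2) - (1 + s * c)) (p / 2 * (a / A0) - c) 0 := by
    have h1 : HasDerivAt (fun s : ℝ => (1 + s * (a / A0)) ^ (p / 2)) (p / 2 * (a / A0)) 0 := by
      have := (((hasDerivAt_id (0:ℝ)).mul_const (a / A0)).const_add 1).rpow_const (p := p / 2) (by simp)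
      simpa [mul_comm] using this
    have h2 : HasDerivAt (fun s : ℝ => 1 + s * c) c 0 := by
      simpa using ((hasDerivAt_id (0:ℝ)).mul_const c).const_add 1
    exact h1.sub h2
  obtain ⟨s0, hs0, hA, -⟩ := deriv_neg_lt hd (by linarith)
  refine ⟨s0, hs0, fun s h1 h2 => ?_⟩
  have := hA s h1 h2
  simp at this
  linarith

lemma emax {p A B A0 : ℝ} (hp : 2 < p) (hA : 0 < A) (hB : 0 < B) (hA0 : 0 < A0)
    (h : (A / A0) ^ (p / 2) < B / A0) :
    ∃ M < (1 / 2 - 1 / p) * A0, ∀ T : ℝ, 0 ≤ T → 1 / 2 * (T ^ 2 * A) - 1 / p * (T ^ p * B) ≤ M := by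
  set K := (A / B) ^ (2 / (p - 2)) with hK
  have hKp : 0 < K := by positivity
  have hc : 0 < 1 / 2 - 1 / p := by
    rw [sub_pos]; exact one_div_lt_one_div_of_lt (by norm_num) hp
  refine ⟨(1 / 2 - 1 / p) * (A * K), ?_, fun T hT => ?_⟩
  · apply mul_lt_mul_of_pos_left _ hc
    set X := A / A0 with hX
    have hXp : 0 < X := by positivity
    have hAX : A = X * A0 := by rw [hX]; field_simp
    have h1 : A / B < X ^ (-((p - 2) / 2)) := by
      have e : X ^ (-((p - 2) / 2)) = X * (X ^ (p / 2))⁻¹ := by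
        rw [← rpow_neg hXp.le, ← rpow_one_add' hXp.le (by intro h; linarith)]
        congr 1; ring
      rw [e, hAX, ← div_eq_mul_inv, div_lt_div_iff₀ hB (by positivity)]
      rw [lt_div_iff₀ hA0] at h
      nlinarith
    have h2 : K < X⁻¹ := by
      rw [hK]
      have := rpow_lt_rpow (by positivity) h1 (show 0 < 2 / (p - 2) from div_pos two_pos (by linarith))
      rw [← rpow_mul hXp.le, show -((p - 2) / 2) * (2 / (p - 2)) = -1 by
        have : p - 2 ≠ 0 := by linarith
        field_simp, rpow_neg_one] at this
      exact this
    calc A * K < A * X⁻¹ := by gcongr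
      _ = A0 := by rw [hX]; field_simp
  · set y := T ^ 2 / K with hy
    have hy0 : 0 ≤ y := by positivity
    have hT2 : T ^ 2 = K * y := by rw [hy]; field_simp
    have hTp : T ^ p = K ^ (p / 2) * y ^ (p / 2) := by
      rw [← mul_rpow hKp.le hy0, ← hT2, ← rpow_natCast, ← rpow_mul hT]
      congr 1; push_cast; ring
    have hKK : K ^ (p / 2) * B = A * K := by
      rw [hK, ← rpow_mul (by positivity), show 2 / (p - 2) * (p / 2) = 1 + 2 / (p - 2) by
        have : p - 2 ≠ 0 := by linarith
        field_simp; ring, rpow_one_add' (by positivity)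
          (by have : 0 < 2 / (p - 2) := div_pos two_pos (by linarith)
              positivity)]
      field_simp
    have hber : 1 + p / 2 * (y - 1) ≤ y ^ (p / 2) := by
      have := one_add_mul_self_le_rpow_one_add (s := y - 1) (by linarith) (p := p / 2) (by linarith)
      simpa using this
    rw [hTp, hT2, show K ^ (p / 2) * y ^ (p / 2) * B = A * K * y ^ (p / 2) by rw [← hKK]; ring]
    have hm := mul_le_mul_of_nonneg_left hber (show 0 ≤ 1 / p * (A * K) by positivity)
    have e : 1 / p * (A * K) * (1 + p / 2 * (y - 1)) = 1 / p * (A * K) + A * K * (y - 1) / 2 := by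
      field_simp
    rw [e] at hm
    nlinarith

lemma s_sq (n : ℕ) (x : Euc N) : sVar n x ^ 2 = ∑ j : Fin N, if (j : ℕ) < n then x j ^ 2 else 0 := by
  rw [sVar, sq_sqrt]
  exact Finset.sum_nonneg fun i _ => by split_ifs <;> positivity
lemma t_sq (n : ℕ) (x : Euc N) : tVar n x ^ 2 = ∑ j : Fin N, if n ≤ (j : ℕ) then x j ^ 2 else 0 := by
  rw [tVar, sq_sqrt]
  exact Finset.sum_nonneg fun i _ => by split_ifs <;> positivity
lemma st_add (n : ℕ) (x : Euc N) : sVar n x ^ 2 + tVar n x ^ 2 = ‖x‖ ^ 2 := by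
  rw [s_sq, t_sq, nsq, ← Finset.sum_add_distrib]
  refine Finset.sum_congr rfl fun i _ => ?_
  by_cases h : (i:ℕ) < n
  · simp [h]
  · simp [h, not_lt.1 h]
lemma st_sub (n : ℕ) (x : Euc N) : sVar n x ^ 2 - tVar n x ^ 2 = DD n x := by
  rw [s_sq, t_sq, DD, ← Finset.sum_sub_distrib]
  refine Finset.sum_congr rfl fun i _ => ?_
  by_cases h : (i:ℕ) < n
  · simp [h, sg]
  · simp [h, not_lt.1 h, sg]

lemma wd_bdd (n : ℕ) {δ : ℝ} (hδ : 0 < δ) (x : Euc N) : |wd n δ x| ≤ n + 1 := by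
  rw [wd_eq, abs_mul, abs_of_nonneg (a1_bd hδ _).1]
  exact (mul_le_of_le_one_left (abs_nonneg _) (a1_bd hδ _).2).trans (psi_bdd n x)

lemma wd_cont (n : ℕ) {δ : ℝ} (hδ : 0 < δ) : Continuous (wd n δ : Euc N → ℝ) :=
  continuous_iff_continuousAt.2 fun x => (hg_wd n hδ x).differentiableAt.continuousAt

lemma grad_smul {v : Euc N → ℝ} (hv : ∀ x, DifferentiableAt ℝ v x) (c : ℝ) (x : Euc N) :
    gradient (fun x => c * v x) x = c • gradient v x := (hg_smul c (hv x).hasGradientAt).gradient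

lemma memH1_smul {v : Euc N → ℝ} (hv : MemH1 v) (c : ℝ) : MemH1 (fun x => c * v x) := by
  obtain ⟨h1, h2, h3, h4⟩ := hv
  refine ⟨by fun_prop, fun x => (h2 x).const_mul c, ?_, ?_⟩
  · simp only [grad_smul h2, norm_smul, mul_pow]
    exact h3.const_mul _
  · simp only [mul_pow]
    exact h4.const_mul _

lemma K_mem {n : ℕ} (hN : 0 < N) {u : Euc N → ℝ} {f : ℝ → ℝ} (hpos : ∀ x, 0 < u x) (hf : ∀ x, u x = f ‖x‖)
    {δ ε c : ℝ} (hδ : 0 < δ) (hε : 0 < ε) (hc : 0 ≤ c) (hε1 : ∀ x : Euc N, 0 ≤ 1 + ε * wd n δ x)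
    (hv : MemH1 fun x => u x * (1 + ε * wd n δ x)) :
    (fun x => c * (u x * (1 + ε * wd n δ x))) ∈ (KplusFull n : Set (Euc N → ℝ)) := by
  refine ⟨memH1_smul hv c, fun x => mul_nonneg hc (mul_nonneg (hpos x).le (hε1 x)), ?_⟩
  refine ⟨fun s t => c * (f (√(s ^ 2 + t ^ 2)) * (1 + ε * (((s ^ 2 + t ^ 2) ^ 2 - (n + 1) * (s ^ 2 - t ^ 2) ^ 2)
    * ((s ^ 2 + t ^ 2) ^ 2 + δ)⁻¹))), fun x => ?_, fun s t => ?_, fun r θ₁ θ₂ hr h1 h12 h2 => ?_⟩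
  · simp only [st_add, st_sub, sqrt_sq (norm_nonneg x), hf, wd, PP]
  · simp only [add_comm (t ^ 2) (s ^ 2)]
    rw [show (t ^ 2 - s ^ 2) ^ 2 = (s ^ 2 - t ^ 2) ^ 2 by ring]
  · have ea : ∀ θ : ℝ, (r * Real.cos θ) ^ 2 + (r * Real.sin θ) ^ 2 = r ^ 2 := fun θ => by
      have := Real.sin_sq_add_cos_sq θ
      linear_combination r ^ 2 * this
    have es : ∀ θ : ℝ, (r * Real.cos θ) ^ 2 - (r * Real.sin θ) ^ 2 = r ^ 2 * Real.cos (2 * θ) := fun θ => by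
      rw [Real.cos_two_mul']; ring
    simp only [ea, es]
    have hfr : 0 < f (√(r ^ 2)) := by
      rw [sqrt_sq hr.le]
      have := hpos (EuclideanSpace.single ⟨0, hN⟩ r)
      rw [hf] at this
      simpa [abs_of_pos hr] using this
    have hcos : Real.cos (2 * θ₂) ≤ Real.cos (2 * θ₁) :=
      Real.cos_le_cos_of_nonneg_of_le_pi (by linarith) (by linarith [Real.pi_pos]) (by linarith)
    have hcos0 : 0 ≤ Real.cos (2 * θ₂) :=
      Real.cos_nonneg_of_neg_pi_div_two_le_of_le (by linarith [Real.pi_pos]) (by linarith)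
    gcongr

lemma energy_smul {v : Euc N → ℝ} (hv : ∀ x, DifferentiableAt ℝ v x) (α p c : ℝ) :
    ∫ x, (‖gradient (fun x => c * v x) x‖ ^ 2 + (c * v x) ^ 2) = c ^ 2 * ∫ x, (‖gradient v x‖ ^ 2 + v x ^ 2) ∧
    ∫ x, ‖x‖ ^ α * |c * v x| ^ p = |c| ^ p * ∫ x, ‖x‖ ^ α * |v x| ^ p := by
  constructor
  · rw [← integral_const_mul]
    congr 1; ext x
    rw [grad_smul hv, norm_smul, mul_pow, Real.norm_eq_abs, sq_abs]; ring
  · rw [← integral_const_mul]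
    congr 1; ext x
    rw [abs_mul, mul_rpow (abs_nonneg _) (abs_nonneg _)]; ring

lemma vnorm_smul {v : Euc N → ℝ} (hv : ∀ x, DifferentiableAt ℝ v x) {α p : ℝ} (hp : 2 < p) (c : ℝ) :
    vnorm α p (fun x => c * v x) = |c| * vnorm α p v := by
  obtain ⟨h1, h2⟩ := energy_smul hv α p c
  unfold vnorm
  rw [h1, h2, mul_rpow (by positivity) (integral_nonneg fun x => by positivity),
    mul_rpow (by positivity) (integral_nonneg fun x => by positivity), ← rpow_mul (abs_nonneg c),
    mul_one_div_cancel (by linarith), rpow_one, ← sqrt_eq_rpow, sqrt_sq_eq_abs]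
  ring

lemma mp_contra {n : ℕ} {α p : ℝ} (hp : 2 < p) {v : Euc N → ℝ} {A B M : ℝ}
    (hK : ∀ c : ℝ, 0 ≤ c → (fun x => c * v x) ∈ (KplusFull n : Set (Euc N → ℝ)))
    (hv : ∀ x, DifferentiableAt ℝ v x) (hv0 : v 0 ≠ 0)
    (hA : ∫ x, (‖gradient v x‖ ^ 2 + v x ^ 2) = A) (hB : ∫ x, ‖x‖ ^ α * |v x| ^ p = B)
    (hA0 : 0 < A) (hB0 : 0 < B) (hM : ∀ T : ℝ, 0 ≤ T → 1 / 2 * (T ^ 2 * A) - 1 / p * (T ^ p * B) ≤ M) :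
    mountainPassLevel α p (KplusFull n : Set (Euc N → ℝ)) ≤ M := by
  have hE : ∀ T : ℝ, 0 ≤ T → energy α p (fun x => T * v x) = 1 / 2 * (T ^ 2 * A) - 1 / p * (T ^ p * B) := by
    intro T hT
    obtain ⟨h1, h2⟩ := energy_smul hv α p T
    rw [energy, h1, h2, hA, hB, abs_of_nonneg hT]
  have hp0 : 0 < p := by linarith
  set T := (p * A / (2 * B)) ^ (1 / (p - 2)) with hT
  have hTp : 0 < T := by positivity
  have hTT : T ^ (p - 2) = p * A / (2 * B) := by
    rw [hT, ← rpow_mul (by positivity), one_div_mul_cancel (by linarith), rpow_one]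
  have hTpp : T ^ p = T ^ 2 * (p * A / (2 * B)) := by
    rw [← hTT, ← rpow_natCast, ← rpow_add hTp]; congr 1; push_cast; ring
  have z0 : (fun x : Euc N => (0 * T) * v x) = 0 := by ext x; simp
  have hE0 : energy α p (0 : Euc N → ℝ) = 0 := by
    have := hE 0 le_rfl
    rw [zero_rpow hp0.ne'] at this
    simp only [zero_mul] at this
    have e : (0 : Euc N → ℝ) = fun x => 0 := rfl
    rw [e, this]; simp
  unfold mountainPassLevel
  refine (csInf_le (a := sSup ((fun t => energy α p (fun x => (t * T) * v x)) '' Icc (0 : ℝ) 1)) ?_ ?_).trans ?_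
  · refine ⟨0, ?_⟩
    rintro c ⟨γ, h1, h2, h3, h4, h5, rfl⟩
    by_cases hb : BddAbove ((fun t => energy α p (γ t)) '' Icc (0 : ℝ) 1)
    · refine le_csSup_of_le hb ⟨0, by simp, rfl⟩ ?_
      simp only [h3, hE0, le_refl]
    · rw [Real.sSup_of_not_bddAbove hb]
  · refine ⟨fun t x => (t * T) * v x, fun t ht => hK _ (mul_nonneg ht.1 hTp.le), ?_, z0, ?_, ?_, rfl⟩
    · intro t ht ε hε
      have hV : 0 ≤ vnorm α p v := by
        unfold vnorm
        have h1 : 0 ≤ ∫ x, (‖gradient v x‖ ^ 2 + v x ^ 2) := by rw [hA]; exact hA0.le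
        have h2 : 0 ≤ ∫ x, ‖x‖ ^ α * |v x| ^ p := by rw [hB]; exact hB0.le
        positivity
      have hTV : 0 < T * vnorm α p v + 1 := by positivity
      refine ⟨ε / (T * vnorm α p v + 1), by positivity, fun s hs hst => ?_⟩
      have e : ((fun x => (s * T) * v x) - fun x => (t * T) * v x) = fun x => ((s - t) * T) * v x := by
        ext x; simp only [Pi.sub_apply]; ring
      rw [e, vnorm_smul hv hp, abs_mul, abs_of_pos hTp, mul_assoc]
      rw [lt_div_iff₀ hTV] at hst
      nlinarith [abs_nonneg (s - t)]
    · intro h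
      have := congrFun h 0
      simp [hTp.ne', hv0] at this
    · show energy α p (fun x => (1 * T) * v x) ≤ 0
      rw [one_mul, hE T hTp.le, hTpp]
      apply le_of_eq
      field_simp
      ring
  · refine csSup_le ((nonempty_Icc.2 zero_le_one).image _) ?_
    rintro _ ⟨t, ht, rfl⟩
    simp only
    rw [hE _ (mul_nonneg ht.1 hTp.le)]
    exact hM _ (mul_nonneg ht.1 hTp.le)

end helpers

/-- Theorem 6.1, part 2: if
`max{4(N+2)/β₁ + 2, (2N+2α−4)/(N−2)} < p < (2N+2α)/(N−2)` then the positive classical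
`K₊` ground state solution of `−Δu + u = |x|^α u^{p−1}` in `ℝ^N` is nonradial. -/
theorem statement13
    (n N : ℕ) (hn : 2 ≤ n) (hN : N = 2 * n)
    (α : ℝ) (hα : 0 < α)
    (p : ℝ)
    (hp1 : max (4 * ((N : ℝ) + 2) / beta1 N + 2) ((2 * N + 2 * α - 4) / ((N : ℝ) - 2)) < p)
    (hp2 : p < (2 * N + 2 * α) / ((N : ℝ) - 2))
    (u : Euc N → ℝ)
    (hu_gs : IsGroundState α p (KplusFull n) u)
    (hu_pos : ∀ x, 0 < u x)
    (hu_reg : ∀ x, ContDiffAt ℝ 2 u x)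
    (hu_eq : ∀ x, - lap u x + u x = ‖x‖ ^ α * u x ^ (p - 1)) :
    ¬ IsRadial u := by
  rintro ⟨f, hf⟩
  obtain ⟨huK, hE0, hEm⟩ := hu_gs
  have hu : MemH1 u := huK.1
  have hC2 : ContDiff ℝ 2 u := contDiff_iff_contDiffAt.2 hu_reg
  have hN4 : 4 ≤ N := by omega
  have : Nonempty (Fin N) := ⟨⟨0, by omega⟩⟩
  obtain ⟨hρi, hρA⟩ := nehari hu hC2 hu_pos hα hu_eq
  obtain ⟨h3, -⟩ := hardy hN4 hu
  have hne : ∀ᵐ x : Euc N, x ≠ 0 := by rw [ae_iff]; simp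
  have h3pos : 0 < ∫ x, u x ^ 2 / ‖x‖ ^ 2 := by
    rw [integral_pos_iff_support_of_nonneg (fun x => by positivity) h3]
    have : ({(0 : Euc N)}ᶜ : Set (Euc N)) ⊆ Function.support fun x => u x ^ 2 / ‖x‖ ^ 2 := by
      intro x hx
      have h1 : ‖x‖ ≠ 0 := norm_ne_zero_iff.2 hx
      have h2 := (hu_pos x).ne'
      simp [h1, h2]
    refine lt_of_lt_of_le ?_ (measure_mono this)
    exact (isOpen_compl_singleton).measure_pos _ ⟨EuclideanSpace.single ⟨0, by omega⟩ 1, by simp⟩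
  obtain ⟨hb1, hb2⟩ := beta1_le hN4 hu h3pos
  have hA0 : ∫ x, ‖x‖ ^ α * u x ^ p = (∫ x, ‖gradient u x‖ ^ 2) + ∫ x, u x ^ 2 := by
    rw [hρA, integral_add hu.2.2.1 hu.2.2.2]
  rw [← hA0] at hb2
  have hApos : 0 < ∫ x, ‖x‖ ^ α * u x ^ p := lt_of_lt_of_le (mul_pos (by linarith) h3pos) hb2
  have hp3 : 4 * ((N : ℝ) + 2) / beta1 N + 2 < p := (le_max_left _ _).trans_lt hp1
  have hq : 4 * ((N:ℝ) + 2) < (p - 2) * beta1 N := by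
    rw [← div_lt_iff₀ (by linarith)]; linarith
  have hp : 2 < p := by
    have : 0 < 4 * ((N : ℝ) + 2) / beta1 N := div_pos (by positivity) (by linarith)
    linarith
  have hlt : 4 * ((N:ℝ) + 2) * ∫ x, u x ^ 2 / ‖x‖ ^ 2 < (p - 2) * ∫ x, ‖x‖ ^ α * u x ^ p := by
    calc _ < (p - 2) * beta1 N * ∫ x, u x ^ 2 / ‖x‖ ^ 2 := by gcongr
      _ = (p - 2) * (beta1 N * ∫ x, u x ^ 2 / ‖x‖ ^ 2) := by ring
      _ ≤ _ := mul_le_mul_of_nonneg_left hb2 (by linarith)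
  obtain ⟨δ, hδ, a, I, hI, haI, hv, hw1, hw2⟩ := test_fun (n := n) (by omega) hN hu hf h3
    (ρ := fun x => ‖x‖ ^ α * u x ^ p) (F := fun r => r ^ α * f r ^ p) (fun x => by simp only [hf]) hρi hρA hApos hlt
  -- the energy of u
  have hEu : energy α p u = (1 / 2 - 1 / p) * ∫ x, ‖x‖ ^ α * u x ^ p := by
    unfold energy
    have e : (fun x => ‖x‖ ^ α * |u x| ^ p) = fun x => ‖x‖ ^ α * u x ^ p := by
      ext x; rw [abs_of_pos (hu_pos x)]
    rw [e, ← hρA]; ring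
  set A0 := ∫ x, ‖x‖ ^ α * u x ^ p with hA0d
  -- choose theta
  obtain ⟨θ, hθ1, hθ2⟩ : ∃ θ < 1, a < θ * ((p - 1) * I) := by
    have hpI : 0 < (p - 1) * I := mul_pos (by linarith) hI
    obtain ⟨m, hm1, hm2⟩ := exists_between haI
    refine ⟨m / ((p - 1) * I), (div_lt_one hpI).2 hm2, ?_⟩
    rw [div_mul_cancel₀ _ hpI.ne']; exact hm1
  obtain ⟨y0, hy0, hy1, hy⟩ := taylor_lb hp hθ1
  obtain ⟨s0, hs0, hs⟩ := small_eps (p := p) (a := a) (A0 := A0) (c := θ * (p * (p - 1) / 2) * I / A0) (by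
    rw [mul_div_assoc', div_lt_div_iff_of_pos_right hApos]
    have := mul_lt_mul_of_pos_left hθ2 (show 0 < p / 2 by linarith)
    linarith)
  -- choose epsilon
  have hCn : (0:ℝ) < n + 1 := by positivity
  obtain ⟨ε, hε, hε1, hε2, hε3⟩ : ∃ ε > 0, ε * (n + 1) ≤ y0 ∧ ε ^ 2 < s0 ∧ 0 < A0 + ε ^ 2 * a := by
    have t1 : Tendsto (fun ε : ℝ => ε * ((n:ℝ) + 1)) (nhdsWithin 0 (Ioi 0)) (nhds 0) := by
      apply tendsto_nhdsWithin_of_tendsto_nhds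
      have : Continuous fun ε : ℝ => ε * ((n:ℝ) + 1) := by fun_prop
      simpa using this.tendsto 0
    have t2 : Tendsto (fun ε : ℝ => ε ^ 2) (nhdsWithin 0 (Ioi 0)) (nhds 0) := by
      apply tendsto_nhdsWithin_of_tendsto_nhds
      have : Continuous fun ε : ℝ => ε ^ 2 := by fun_prop
      simpa using this.tendsto 0
    have t3 : Tendsto (fun ε : ℝ => A0 + ε ^ 2 * a) (nhdsWithin 0 (Ioi 0)) (nhds A0) := by
      simpa using (t2.mul_const a).const_add A0
    obtain ⟨ε, ⟨⟨h1, h2⟩, h3⟩, h4⟩ := (((t1.eventually_le_const hy0).and (t2.eventually_lt_const hs0)).and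
      (t3.eventually_const_lt hApos)).and self_mem_nhdsWithin |>.exists
    exact ⟨ε, h4, h1, h2, h3⟩
  obtain ⟨hvH, hvA⟩ := hv ε
  have hwb : ∀ x : Euc N, |ε * wd n δ x| ≤ y0 := fun x => by
    rw [abs_mul, abs_of_pos hε]
    exact (mul_le_mul_of_nonneg_left (wd_bdd n hδ x) hε.le).trans hε1
  have hw0 : ∀ x : Euc N, 0 ≤ 1 + ε * wd n δ x := fun x => by
    have := (abs_le.1 (hwb x)).1; linarith
  have hw2' : ∀ x : Euc N, 1 + ε * wd n δ x ≤ 2 := fun x => by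
    have := (abs_le.1 (hwb x)).2; linarith
  have hwc := wd_cont (N := N) n hδ
  have hBi : Integrable fun x => ‖x‖ ^ α * u x ^ p * (1 + ε * wd n δ x) ^ p := by
    have hm : Measurable fun x : Euc N => (1 + ε * wd n δ x) ^ p := by
      have := hwc.measurable
      fun_prop
    refine (int_bm (C := 2 ^ p) hρi hm fun x => ?_).congr (ae_of_all _ fun x => mul_comm _ _)
    rw [abs_of_nonneg (rpow_nonneg (hw0 x) _)]
    exact rpow_le_rpow (hw0 x) (hw2' x) (by linarith)
  have hwi1 : Integrable fun x => ‖x‖ ^ α * u x ^ p * wd n δ x :=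
    (int_bm hρi hwc.measurable (wd_bdd n hδ)).congr (ae_of_all _ fun x => mul_comm _ _)
  have hwi2 : Integrable fun x => ‖x‖ ^ α * u x ^ p * wd n δ x ^ 2 :=
    (int_bm hwi1 hwc.measurable (wd_bdd n hδ)).congr (ae_of_all _ fun x => by simp only; ring)
  set B := ∫ x, ‖x‖ ^ α * u x ^ p * (1 + ε * wd n δ x) ^ p with hB
  have hBge : A0 + ε ^ 2 * (θ * (p * (p - 1) / 2) * I) ≤ B := by
    have i2 : Integrable fun x => ‖x‖ ^ α * u x ^ p + p * ε * (‖x‖ ^ α * u x ^ p * wd n δ x) :=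
      hρi.add (hwi1.const_mul (p * ε))
    have i3 := hwi2.const_mul (ε ^ 2 * (θ * (p * (p - 1) / 2)))
    calc A0 + ε ^ 2 * (θ * (p * (p - 1) / 2) * I)
        = ∫ x, ((‖x‖ ^ α * u x ^ p + p * ε * (‖x‖ ^ α * u x ^ p * wd n δ x))
          + ε ^ 2 * (θ * (p * (p - 1) / 2)) * (‖x‖ ^ α * u x ^ p * wd n δ x ^ 2)) := by
          rw [integral_add i2 i3, integral_add hρi (hwi1.const_mul (p * ε)), integral_const_mul,
            integral_const_mul, hw1, hw2]; ring
      _ ≤ B := by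
          refine integral_mono (i2.add i3) hBi fun x => ?_
          have hρ0 : 0 ≤ ‖x‖ ^ α * u x ^ p := mul_nonneg (by positivity) (rpow_nonneg (hu_pos x).le _)
          have := mul_le_mul_of_nonneg_left (hy _ (hwb x)) hρ0
          simp only [Pi.add_apply]
          linarith
  have hkey : ((A0 + ε ^ 2 * a) / A0) ^ (p / 2) < B / A0 := by
    have h1 := hs (ε ^ 2) (by positivity) hε2
    have e1 : (A0 + ε ^ 2 * a) / A0 = 1 + ε ^ 2 * (a / A0) := by field_simp
    have e2 : 1 + ε ^ 2 * (θ * (p * (p - 1) / 2) * I / A0) = (A0 + ε ^ 2 * (θ * (p * (p - 1) / 2) * I)) / A0 := by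
      field_simp
    rw [e1]
    rw [e2] at h1
    exact h1.trans_le (div_le_div_of_nonneg_right hBge hApos.le)
  have hBpos : 0 < B := by
    have h1 : 0 < B / A0 := lt_of_le_of_lt (by positivity) hkey
    by_contra hB0
    exact absurd h1 (not_lt.2 (div_nonpos_of_nonpos_of_nonneg (not_lt.1 hB0) hApos.le))
  obtain ⟨M, hM1, hM2⟩ := emax hp hε3 hBpos hApos hkey
  have hBv : ∫ x, ‖x‖ ^ α * |u x * (1 + ε * wd n δ x)| ^ p = B := by
    rw [hB]; congr 1; ext x
    rw [abs_of_nonneg (mul_nonneg (hu_pos x).le (hw0 x)), mul_rpow (hu_pos x).le (hw0 x), mul_assoc]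
  have hfin := mp_contra (n := n) (α := α) hp (v := fun x => u x * (1 + ε * wd n δ x))
    (fun c hc => K_mem (by omega) hu_pos hf hδ hε hc hw0 hvH) hvH.2.1
    (by
      have := (hu_pos 0).ne'
      simp [wd, PP, DD, this]) hvA hBv hε3 hBpos hM2
  rw [← hEm, hEu] at hfin
  linarith


end
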